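/- Let G be a countable infinite amenable group. Then the set of values of the mean topological dimension of minimal G-systems is all of [0, +∞]: for every ρ ∈ [0, +∞] there exists a minimal G-system (X, G) with mdim(X, G) = ρ. -/

import Mathlib

open Filter Topology Pointwise ENNReal

/-- A Følner sequence for a group `G`. -/
def IsFolnerSeq (G : Type*) [Group G] (F : ℕ → Finset G) : Prop :=
  (∀ n, (F n).Nonempty) ∧
    ∀ g : G, Filter.Tendsto
      (fun n => ((symmDiff (g • ((F n) : Set G)) ((F n) : Set G)).ncard : ℝ) / (F n).card)
      Filter.atTop (nhds 0)

/-- A group is amenable if it admits a Følner sequence. -/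
def IsAmenable (G : Type*) [Group G] : Prop := ∃ F : ℕ → Finset G, IsFolnerSeq G F

variable {G : Type*} [Group G]

/-- The `K`-boundary of a finite set `A`. -/
def kBoundary (A K : Finset G) : Set G :=
  {g : G | (∃ k ∈ K, k * g ∈ A) ∧ ∃ k ∈ K, k * g ∉ A}

/-- `A` is `(K, δ)`-invariant. -/
def InvariantSet (A K : Finset G) (δ : ℝ) : Prop :=
  ((kBoundary A K).ncard : ℝ) < δ * A.card

/-- A subset of a group is syndetic if finitely many translates cover the group. -/
def Syndetic (A : Set G) : Prop := ∃ F : Finset G, (F : Set G) * A = Set.univ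

/-- A finite tiling of a group `G`: a partition of `G` into right translates of
finitely many finite shapes, each shape containing the identity. -/
structure FiniteTiling (G : Type*) [Group G] where
  tiles : Set (Set G)
  shapes : Finset (Finset G)
  covers : ∀ g : G, ∃! t, t ∈ tiles ∧ g ∈ t
  tile_shape : ∀ t ∈ tiles, ∃ S ∈ shapes, ∃ c : G, t = (S : Set G) * {c}
  one_mem_shape : ∀ S ∈ shapes, (1 : G) ∈ S

/-- The set of centers of a shape `S` in a tiling. -/
def FiniteTiling.center (T : FiniteTiling G) (S : Finset G) : Set G :=
  {c : G | ((S : Set G) * {c}) ∈ T.tiles}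

/-- A finite tiling is irreducible if every sufficiently invariant finite set
contains a tile of every shape. -/
def FiniteTiling.IsIrreducible (T : FiniteTiling G) : Prop :=
  ∃ (T₀ : Finset G) (ε : ℝ), 0 < ε ∧
    ∀ F : Finset G, InvariantSet F T₀ ε →
      ∀ S ∈ T.shapes, ∃ c ∈ T.center S, (S : Set G) * {c} ⊆ (F : Set G)

/-- The shift action of `G` on `A^G`: `(c • x) g = x (g * c)`. -/
def shiftAct {A : Type*} (c : G) (x : G → A) : G → A := fun g => x (g * c)

instance : TopologicalSpace (Option (Finset G)) := ⊥

open Classical in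
/-- The point of `(S(T) ∪ {0})^G` encoding the centers of a tiling. -/
noncomputable def FiniteTiling.point (T : FiniteTiling G) : G → Option (Finset G) :=
  fun g => if h : ∃ S, S ∈ T.shapes ∧ g ∈ T.center S then some h.choose else none

/-- The subshift associated with a finite tiling: the orbit closure of `T.point`. -/
noncomputable def FiniteTiling.subshift (T : FiniteTiling G) : Set (G → Option (Finset G)) :=
  closure (Set.range fun c : G => shiftAct c T.point)

/-- `T₂` is primely congruent with `T₁`: tiles of `T₂` are unions of tiles of `T₁`
and each shape of `T₂` has a unique master partition by tiles of `T₁`. -/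
def PrimelyCongruent (T₁ T₂ : FiniteTiling G) : Prop :=
  (∀ t₁ ∈ T₁.tiles, ∀ t₂ ∈ T₂.tiles, (t₁ ∩ t₂).Nonempty → t₁ ⊆ t₂) ∧
  ∀ S ∈ T₂.shapes, ∀ c c' : G, c ∈ T₂.center S → c' ∈ T₂.center S →
    {u : Set G | ∃ t ∈ T₁.tiles, t ⊆ (S : Set G) * {c} ∧ u = t * {c⁻¹}} =
    {u : Set G | ∃ t ∈ T₁.tiles, t ⊆ (S : Set G) * {c'} ∧ u = t * {c'⁻¹}}

/-- Number of patterns of a subshift on a finite window `F`. -/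
noncomputable def patternCount {A : Type*} (X : Set (G → A)) (F : Finset G) : ℕ :=
  {p : ↑F → A | ∃ x ∈ X, ∀ g : ↑F, x (g : G) = p g}.ncard

section Dim

variable {Y : Type*} [TopologicalSpace Y]

/-- `β` is a finite open cover of the set `X`. -/
def IsOpenCoverOf (X : Set Y) (β : Finset (Set Y)) : Prop :=
  (∀ U ∈ β, IsOpen U) ∧ X ⊆ ⋃ U ∈ β, U

/-- The order of a finite cover on a set `X`. -/
noncomputable def ordOn (X : Set Y) (β : Finset (Set Y)) : ℕ :=
  ⨆ y : X, ({U : Set Y | U ∈ β ∧ (y : Y) ∈ U}.ncard - 1)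

/-- `D(α)`: minimal order among finite open covers of `X` refining `α`. -/
noncomputable def Dcov (X : Set Y) (α : Finset (Set Y)) : ℕ :=
  sInf {n | ∃ β : Finset (Set Y), IsOpenCoverOf X β ∧
    (∀ U ∈ β, ∃ V ∈ α, U ⊆ V) ∧ ordOn X β = n}

/-- The topological (covering) dimension of a subset `X` of a topological space. -/
noncomputable def topDim (X : Set Y) : ℕ∞ :=
  ⨆ α ∈ {α : Finset (Set Y) | IsOpenCoverOf X α}, (Dcov X α : ℕ∞)

/-- The join `⋁_{g ∈ F} (σ g)⁻¹ α` of the pullbacks of a finite cover along an action. -/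
noncomputable def FCover {H : Type*} (σ : H → Y → Y) (F : Finset H) (α : Finset (Set Y)) :
    Finset (Set Y) :=
  letI := Classical.decEq H
  letI := Classical.decEq (Set Y)
  (F.pi fun _ => α).image fun f => ⋂ g, ⋂ (h : g ∈ F), σ g ⁻¹' f g h

/-- Mean topological dimension of `X` with respect to an action `σ` of `G`,
computed along the Følner sequence `Fo`. -/
noncomputable def mdim {H : Type*} (σ : H → Y → Y) (X : Set Y) (Fo : ℕ → Finset H) : ℝ≥0∞ :=
  ⨆ α ∈ {α : Finset (Set Y) | IsOpenCoverOf X α},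
    Filter.limsup
      (fun n => (Dcov X (FCover σ (Fo n) α) : ℝ≥0∞) / ((Fo n).card : ℝ≥0∞))
      Filter.atTop

end Dim

/-- A polyhedron: a finite union of simplices (convex hulls of finite sets) in a
Euclidean space. -/
def IsPolyhedron {N : ℕ} (P : Set (EuclideanSpace ℝ (Fin N))) : Prop :=
  ∃ S : Finset (Finset (EuclideanSpace ℝ (Fin N))),
    P = ⋃ s ∈ S, convexHull ℝ (s : Set (EuclideanSpace ℝ (Fin N)))

/-- The upper (Banach) density of a subset of an amenable group. -/
noncomputable def upperDensity (G : Type*) [Group G] (J : Set G) : ℝ :=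
  sSup {r : ℝ | ∃ Fo : ℕ → Finset G, IsFolnerSeq G Fo ∧
    r = Filter.limsup (fun n => ((J ∩ (Fo n : Set G)).ncard : ℝ) / (Fo n).card) Filter.atTop}


/-- A `G`-system: a compact metrizable space with a continuous action of `G`. -/
structure GSystem (G : Type*) [Group G] where
  X : Type
  [ms : MetricSpace X]
  compact : CompactSpace X
  act : G → X → X
  cont : ∀ g : G, Continuous (act g)
  act_one : act 1 = id
  act_mul : ∀ g h : G, act (g * h) = act g ∘ act h

attribute [instance] GSystem.ms

/-! ### A cubical Sperner lemma -/

/-- The `k`-th vertex of the simplex with base point `v` and direction order `τ` in the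
Freudenthal triangulation of the integer grid. -/
def kuhnVertex {n : ℕ} (v : Fin n → ℕ) (τ : Equiv.Perm (Fin n)) (k : ℕ) : Fin n → ℕ :=
  fun i => v i + if (τ i : ℕ) < k then 1 else 0

/-- The simplices of the triangulated grid `{0, …, N}ⁿ` carrying all the colors `0, …, n`. -/
def rainbowSimplices (n N : ℕ) (l : (Fin n → ℕ) → ℕ) :
    Finset ((Fin n → ℕ) × Equiv.Perm (Fin n)) :=
  {s ∈ (Fintype.piFinset fun _ => Finset.range N) ×ˢ Finset.univ |
    ∀ c ≤ n, ∃ k ≤ n, l (kuhnVertex s.1 s.2 k) = c}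

/-- Extension of a permutation of `Fin n` to `Fin (n + 1)` fixing the last element. -/
def permSnoc {n : ℕ} (σ : Equiv.Perm (Fin n)) : Equiv.Perm (Fin (n + 1)) :=
  finSuccEquivLast.trans (σ.optionCongr.trans finSuccEquivLast.symm)

lemma permSnoc_castSucc {n : ℕ} (σ : Equiv.Perm (Fin n)) (i : Fin n) :
    permSnoc σ i.castSucc = (σ i).castSucc := by
  simp [permSnoc]

lemma permSnoc_last {n : ℕ} (σ : Equiv.Perm (Fin n)) :
    permSnoc σ (Fin.last n) = Fin.last n := by
  simp [permSnoc]

lemma permSnoc_injective {n : ℕ} : Function.Injective (permSnoc (n := n)) := by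
  intro σ σ' h
  ext i
  have := congrArg (fun τ => τ i.castSucc) h
  simpa [permSnoc_castSucc] using congrArg Fin.val this

lemma exists_permSnoc_eq {n : ℕ} (τ : Equiv.Perm (Fin (n + 1)))
    (h : τ (Fin.last n) = Fin.last n) : ∃ σ, permSnoc σ = τ := by
  have hne : ∀ i : Fin n, τ i.castSucc ≠ Fin.last n := fun i hi => by
    have := τ.injective (hi.trans h.symm)
    exact (Fin.castSucc_lt_last i).ne this
  let f : Fin n → Fin n := fun i => (τ i.castSucc).castPred (hne i)
  have hf : Function.Injective f := fun i j hij => by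
    simpa [f] using hij
  refine ⟨Equiv.ofBijective f (Finite.injective_iff_bijective.1 hf), ?_⟩
  ext i
  refine Fin.lastCases ?_ (fun i => ?_) i
  · rw [permSnoc_last, h]
  · rw [permSnoc_castSucc]; simp [f]

/-- Among the facets of a simplex with vertices colored by `f`, the number of those carrying
exactly the colors `0, …, n` is odd iff the simplex carries all colors. -/
lemma card_facets_mod_two (n : ℕ) (f : ℕ → ℕ) (hf : ∀ k ≤ n + 1, f k ≤ n + 1) :
    ((({j ∈ Finset.range (n + 2) | ∀ c ≤ n, ∃ k ≤ n + 1, k ≠ j ∧ f k = c} : Finset ℕ).card : ℕ) :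
      ZMod 2) = if ∀ c ≤ n + 1, ∃ k ≤ n + 1, f k = c then 1 else 0 := by
  classical
  by_cases hs : ∀ c ≤ n, ∃ k ≤ n + 1, f k = c
  swap
  · rw [if_neg fun h => hs fun c hc => h c (by omega), Finset.card_eq_zero.2]
    · simp
    · refine Finset.filter_eq_empty_iff.2 fun j _ hj => hs fun c hc => ?_
      obtain ⟨k, hk, -, h⟩ := hj c hc
      exact ⟨k, hk, h⟩
  by_cases hfull : ∀ c ≤ n + 1, ∃ k ≤ n + 1, f k = c
  · rw [if_pos hfull]
    have hsurj : Set.SurjOn f (Finset.range (n + 2)) (Finset.range (n + 2)) := fun c hc => by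
      obtain ⟨k, hk, h⟩ := hfull c (by simpa [Nat.lt_succ_iff] using hc)
      exact ⟨k, by simp; omega, h⟩
    have hinj : Set.InjOn f (Finset.range (n + 2)) :=
      Finset.injOn_of_surjOn_of_card_le f (fun k hk => by
        have := hf k (by simp at hk; omega)
        simp; omega) hsurj le_rfl
    obtain ⟨j₀, hj₀, hj₀f⟩ := hfull (n + 1) le_rfl
    have : ({j ∈ Finset.range (n + 2) | ∀ c ≤ n, ∃ k ≤ n + 1, k ≠ j ∧ f k = c} : Finset ℕ) =
        {j₀} := by
      ext j
      simp only [Finset.mem_filter, Finset.mem_range, Finset.mem_singleton]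
      constructor
      · rintro ⟨hj, h⟩
        by_contra hne
        have hfj : f j ≤ n := by
          have h1 := hf j (by omega)
          have h2 : f j ≠ n + 1 := fun h2 => hne (hinj (by simpa using hj)
            (by simp; omega) (h2.trans hj₀f.symm))
          omega
        obtain ⟨k, hk, hkj, hkc⟩ := h _ hfj
        exact hkj (hinj (by simp; omega) (by simpa using hj) hkc)
      · rintro rfl
        refine ⟨by omega, fun c hc => ?_⟩
        obtain ⟨k, hk, h⟩ := hs c hc
        exact ⟨k, hk, fun hkj => by subst hkj; omega, h⟩
    rw [this]; simp
  · rw [if_neg hfull]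
    have hlt : ∀ k ≤ n + 1, f k ≤ n := fun k hk => by
      by_contra hlt
      refine hfull fun c hc => ?_
      rcases Nat.lt_or_ge n c with h | h
      · exact ⟨k, hk, by have := hf k hk; omega⟩
      · exact hs c h
    obtain ⟨a, ha, b, hb, hab, hfab⟩ := Finset.exists_ne_map_eq_of_card_lt_of_maps_to
      (s := Finset.range (n + 2)) (t := Finset.range (n + 1)) (f := f) (by simp)
      (fun k hk => by
        have := hlt k (by simp at hk; omega)
        simp; omega)
    have : ({j ∈ Finset.range (n + 2) | ∀ c ≤ n, ∃ k ≤ n + 1, k ≠ j ∧ f k = c} : Finset ℕ) =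
        {a, b} := by
      simp only [Finset.mem_range] at ha hb
      ext j
      simp only [Finset.mem_filter, Finset.mem_range, Finset.mem_insert, Finset.mem_singleton]
      constructor
      · rintro ⟨hj, h⟩
        by_contra! hne
        have hsub : Finset.range (n + 1) ⊆
            (((Finset.range (n + 2)).erase j).erase a).image f := fun c hc => by
          obtain ⟨k, hk, hkj, hkc⟩ := h c (by simp at hc; omega)
          by_cases hka : k = a
          · exact Finset.mem_image.2 ⟨b, by simp [hne.2.symm, hab.symm]; omega,
              by rw [← hfab, ← hka, hkc]⟩
          · exact Finset.mem_image.2 ⟨k, by simp [hka, hkj]; omega, hkc⟩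
        have h1 := (Finset.card_le_card hsub).trans Finset.card_image_le
        rw [Finset.card_erase_of_mem (by simp [hne.1.symm]; omega),
          Finset.card_erase_of_mem (by simp; omega)] at h1
        simp at h1
      · intro hj
        have hj' : j < n + 2 := by rcases hj with rfl | rfl <;> assumption
        refine ⟨hj', fun c hc => ?_⟩
        obtain ⟨k, hk, h⟩ := hs c hc
        rcases hj with rfl | rfl
        · by_cases hkj : k = j
          · exact ⟨b, by omega, hab.symm, by rw [← hfab, ← hkj, h]⟩
          · exact ⟨k, hk, hkj, h⟩
        · by_cases hkj : k = j
          · exact ⟨a, by omega, hab, by rw [hfab, ← hkj, h]⟩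
          · exact ⟨k, hk, hkj, h⟩
    rw [this, Finset.card_pair hab]
    rfl

/-- The simplices of the `(n + 1)`-dimensional grid whose facet opposite to the `j`-th vertex
carries all the colors `0, …, n`. -/
def rainbowFacets (n N : ℕ) (l : (Fin (n + 1) → ℕ) → ℕ) (j : ℕ) :
    Finset ((Fin (n + 1) → ℕ) × Equiv.Perm (Fin (n + 1))) :=
  {s ∈ (Fintype.piFinset fun _ => Finset.range N) ×ˢ Finset.univ |
    ∀ c ≤ n, ∃ k ≤ n + 1, k ≠ j ∧ l (kuhnVertex s.1 s.2 k) = c}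

lemma card_rainbowSimplices_eq_sum (n N : ℕ) (l : (Fin (n + 1) → ℕ) → ℕ)
    (hl : ∀ x, l x ≤ n + 1) :
    ((rainbowSimplices (n + 1) N l).card : ZMod 2) =
      ∑ j ∈ Finset.range (n + 2), ((rainbowFacets n N l j).card : ZMod 2) := by
  classical
  have h1 : ∀ j, ((rainbowFacets n N l j).card : ZMod 2) =
      ∑ s ∈ (Fintype.piFinset fun _ : Fin (n + 1) => Finset.range N) ×ˢ
        (Finset.univ : Finset (Equiv.Perm (Fin (n + 1)))),
        if ∀ c ≤ n, ∃ k ≤ n + 1, k ≠ j ∧ l (kuhnVertex s.1 s.2 k) = c then (1 : ZMod 2) else 0 := by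
    intro j
    rw [rainbowFacets, Finset.card_filter]
    push_cast
    rfl
  simp_rw [h1]
  rw [Finset.sum_comm, rainbowSimplices, Finset.card_filter]
  push_cast
  refine Finset.sum_congr rfl fun s _ => ?_
  rw [← card_facets_mod_two n (fun k => l (kuhnVertex s.1 s.2 k)) fun _ _ => hl _,
    Finset.card_filter]
  push_cast
  rfl

lemma card_rainbowFacets_of_interior (n N : ℕ) (l : (Fin (n + 1) → ℕ) → ℕ) (j : ℕ)
    (hj : j < n) : ((rainbowFacets n N l (j + 1)).card : ZMod 2) = 0 := by
  classical
  let a : Fin (n + 1) := ⟨j, by omega⟩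
  let b : Fin (n + 1) := ⟨j + 1, by omega⟩
  have hab : a ≠ b := by simp [a, b]
  have key : ∀ v (τ : Equiv.Perm (Fin (n + 1))) k, k ≠ j + 1 →
      kuhnVertex v (τ.trans (Equiv.swap a b)) k = kuhnVertex v τ k := by
    intro v τ k hk
    funext i
    simp only [kuhnVertex, Equiv.trans_apply]
    congr 1
    have : ((Equiv.swap a b (τ i) : Fin (n + 1)) : ℕ) < k ↔ (τ i : ℕ) < k := by
      rcases eq_or_ne (τ i) a with h | h
      · rw [h, Equiv.swap_apply_left]; simp only [a, b]; omega
      rcases eq_or_ne (τ i) b with h' | h'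
      · rw [h', Equiv.swap_apply_right]; simp only [a, b]; omega
      · rw [Equiv.swap_apply_of_ne_of_ne h h']
    simp only [this]
  rw [Finset.card_eq_sum_ones]
  push_cast
  refine Finset.sum_involution (fun s _ => (s.1, s.2.trans (Equiv.swap a b))) ?_ ?_ ?_ ?_
  · intros; rfl
  · rintro ⟨v, τ⟩ - - h
    have h2 : τ.trans (Equiv.swap a b) = τ := congrArg Prod.snd h
    have := congrArg (fun e => e (τ.symm a)) h2
    simp at this
    exact hab this.symm
  · rintro ⟨v, τ⟩ h
    simp only [rainbowFacets, Finset.mem_filter, Finset.mem_product, Finset.mem_univ,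
      and_true] at h ⊢
    refine ⟨h.1, fun c hc => ?_⟩
    obtain ⟨k, hk, hkj, hkc⟩ := h.2 c hc
    exact ⟨k, hk, hkj, by rw [key v τ k hkj, hkc]⟩
  · rintro ⟨v, τ⟩ -
    ext i <;> simp

lemma kuhnVertex_succ {n : ℕ} (v : Fin (n + 1) → ℕ) (τ : Equiv.Perm (Fin (n + 1)))
    (k : ℕ) (hk : k ≤ n) :
    kuhnVertex v (τ.trans (finRotate (n + 1))) (k + 1) =
      kuhnVertex (v + Pi.single (τ.symm (Fin.last n)) 1) τ k := by
  funext i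
  simp only [kuhnVertex, Equiv.trans_apply, Pi.add_apply, coe_finRotate]
  by_cases h : τ i = Fin.last n
  · have hi : i = τ.symm (Fin.last n) := by rw [← h]; simp
    rw [if_pos h, h, ← hi]
    simp [hk]
  · have hi : i ≠ τ.symm (Fin.last n) := fun hi => h (by rw [hi]; simp)
    rw [if_neg h]
    simp [hi]

/-- Colorings of the grid `{0, …, N}ⁿ` to which the cubical Sperner lemma applies. -/
structure IsSpernerColoring (n N : ℕ) (l : (Fin n → ℕ) → ℕ) : Prop where
  le : ∀ x, l x ≤ n
  of_eq_zero : ∀ x (i : Fin n), x i = 0 → l x ≤ i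
  of_eq_top : ∀ x (i : Fin n), x i = N → l x ≠ i

lemma IsSpernerColoring.snoc {n N : ℕ} {l : (Fin (n + 1) → ℕ) → ℕ}
    (h : IsSpernerColoring (n + 1) N l) :
    IsSpernerColoring n N fun x => l (Fin.snoc x 0) where
  le x := h.of_eq_zero _ (Fin.last n) (by simp)
  of_eq_zero x i hi := h.of_eq_zero _ i.castSucc (by simpa using hi)
  of_eq_top x i hi := h.of_eq_top _ i.castSucc (by simpa using hi)

lemma card_rainbowFacets_zero {n N : ℕ} {l : (Fin (n + 1) → ℕ) → ℕ}
    (h : IsSpernerColoring (n + 1) N l) :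
    (rainbowFacets n N l 0).card =
      ({s ∈ rainbowFacets n N l (n + 1) | s.1 (s.2.symm (Fin.last n)) ≠ 0}).card := by
  classical
  symm
  refine Finset.card_nbij'
    (fun s => (s.1 - Pi.single (s.2.symm (Fin.last n)) 1, s.2.trans (finRotate (n + 1))))
    (fun s => (s.1 + Pi.single (s.2.symm 0) 1, s.2.trans (finRotate (n + 1)).symm)) ?_ ?_ ?_ ?_
  · rintro ⟨v, τ⟩ hs
    simp only [rainbowFacets, Finset.coe_filter, Finset.mem_filter, Finset.mem_product,
      Fintype.mem_piFinset, Finset.mem_range, Finset.mem_univ, and_true, Set.mem_ofPred_eq] at hs ⊢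
    obtain ⟨⟨hv, hc⟩, h0⟩ := hs
    refine ⟨fun i => lt_of_le_of_lt (by simp) (hv i), fun c hcn => ?_⟩
    obtain ⟨k, hk, hkn, hkc⟩ := hc c hcn
    refine ⟨k + 1, by omega, by omega, ?_⟩
    rw [kuhnVertex_succ _ _ _ (by omega), ← hkc]
    congr 2
    funext i
    by_cases hi : i = τ.symm (Fin.last n)
    · subst hi; simp; omega
    · simp [hi]
  · rintro ⟨v, τ⟩ hs
    simp only [rainbowFacets, Finset.coe_filter, Finset.mem_filter, Finset.mem_product,
      Fintype.mem_piFinset, Finset.mem_range, Finset.mem_univ, and_true, Set.mem_ofPred_eq] at hs ⊢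
    obtain ⟨hv, hc⟩ := hs
    have hlast : (τ.trans (finRotate (n + 1)).symm).symm (Fin.last n) = τ.symm 0 := by
      simp
    have hvert : ∀ k ≤ n, kuhnVertex v τ (k + 1) = kuhnVertex (v + Pi.single (τ.symm 0) 1)
        (τ.trans (finRotate (n + 1)).symm) k := fun k hk => by
      have := kuhnVertex_succ v (τ.trans (finRotate (n + 1)).symm) k hk
      rw [hlast] at this
      rw [← this]
      congr 1
      ext i; simp
    refine ⟨⟨fun i => ?_, fun c hcn => ?_⟩, ?_⟩
    · by_cases hi : i = τ.symm 0
      · obtain ⟨k, hk, hk0, hkc⟩ := hc (τ.symm 0 : Fin (n + 1)) (by omega)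
        have h1 := h.of_eq_top (kuhnVertex v τ k) (τ.symm 0)
        have h2 := hv (τ.symm 0)
        have h3 : kuhnVertex v τ k (τ.symm 0) = v (τ.symm 0) + 1 := by
          simp [kuhnVertex]; omega
        rw [hi]
        simp only [Pi.add_apply, Pi.single_eq_same]
        by_contra hlt
        exact h1 (by omega) hkc
      · simpa [hi] using hv i
    · obtain ⟨k, hk, hk0, hkc⟩ := hc c hcn
      obtain ⟨k, rfl⟩ := Nat.exists_eq_succ_of_ne_zero hk0
      exact ⟨k, by omega, by omega, by rw [← hvert k (by omega)]; exact hkc⟩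
    · rw [hlast]; simp
  · rintro ⟨v, τ⟩ hs
    simp only [Finset.coe_filter, Set.mem_ofPred_eq] at hs
    have hlast : (τ.trans (finRotate (n + 1))).symm 0 = τ.symm (Fin.last n) := by
      rw [Equiv.symm_trans_apply, ← finRotate_last, Equiv.symm_apply_apply]
    simp only [hlast]
    ext i
    · by_cases hi : i = τ.symm (Fin.last n)
      · subst hi; simp; omega
      · simp [hi]
    · simp
  · rintro ⟨v, τ⟩ hs
    have hlast : (τ.trans (finRotate (n + 1)).symm).symm (Fin.last n) = τ.symm 0 := by
      simp
    simp only [hlast]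
    ext i <;> simp

lemma card_rainbowFacets_last {n N : ℕ} (hN : 0 < N) {l : (Fin (n + 1) → ℕ) → ℕ}
    (h : IsSpernerColoring (n + 1) N l) :
    ({s ∈ rainbowFacets n N l (n + 1) | ¬ s.1 (s.2.symm (Fin.last n)) ≠ 0}).card =
      (rainbowSimplices n N fun x => l (Fin.snoc x 0)).card := by
  classical
  have hvert : ∀ (v : Fin n → ℕ) σ k, k ≤ n →
      kuhnVertex (Fin.snoc v 0 : Fin (n + 1) → ℕ) (permSnoc σ) k =
        Fin.snoc (kuhnVertex v σ k) 0 := by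
    intro v σ k hk
    funext i
    refine Fin.lastCases ?_ (fun i => ?_) i
    · simp [kuhnVertex, permSnoc_last, hk]
    · simp [kuhnVertex, permSnoc_castSucc]
  symm
  refine Finset.card_bij (fun s _ => (Fin.snoc s.1 0, permSnoc s.2)) ?_ ?_ ?_
  · rintro ⟨v, σ⟩ hs
    simp only [rainbowSimplices, rainbowFacets, Finset.mem_filter, Finset.mem_product,
      Fintype.mem_piFinset, Finset.mem_range, Finset.mem_univ, and_true] at hs ⊢
    refine ⟨⟨fun i => ?_, fun c hc => ?_⟩, ?_⟩
    · refine Fin.lastCases ?_ (fun i => ?_) i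
      · simpa using hN
      · simpa using hs.1 i
    · obtain ⟨k, hk, hkc⟩ := hs.2 c hc
      exact ⟨k, by omega, by omega, by rw [hvert _ _ _ hk, hkc]⟩
    · have : (permSnoc σ).symm (Fin.last n) = Fin.last n := by
        rw [Equiv.symm_apply_eq, permSnoc_last]
      simp [this]
  · rintro ⟨v, σ⟩ - ⟨v', σ'⟩ - heq
    simp only [Prod.mk.injEq] at heq
    refine Prod.ext ?_ (permSnoc_injective heq.2)
    funext i
    simpa using congrFun heq.1 i.castSucc
  · rintro ⟨v, τ⟩ hs
    simp only [rainbowSimplices, rainbowFacets, Finset.mem_filter, Finset.mem_product,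
      Fintype.mem_piFinset, Finset.mem_range, Finset.mem_univ, and_true, not_not] at hs ⊢
    obtain ⟨⟨hv, hc⟩, h0⟩ := hs
    have hr : τ.symm (Fin.last n) = Fin.last n := by
      obtain ⟨k, hk, hkn, hkc⟩ := hc n le_rfl
      have h1 := h.of_eq_zero (kuhnVertex v τ k) (τ.symm (Fin.last n)) (by
        simp [kuhnVertex, h0]; omega)
      rw [hkc] at h1
      exact le_antisymm (Fin.le_last _) h1
    obtain ⟨σ, rfl⟩ := exists_permSnoc_eq τ (by rw [← hr, τ.apply_symm_apply, hr])
    rw [hr] at h0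
    have hsnoc : (Fin.snoc (fun i : Fin n => v i.castSucc) 0 : Fin (n + 1) → ℕ) = v := by
      funext i
      refine Fin.lastCases ?_ (fun i => ?_) i <;> simp [h0]
    refine ⟨(fun i => v i.castSucc, σ), ⟨fun i => hv _, fun c hcn => ?_⟩, by simp [hsnoc]⟩
    obtain ⟨k, hk, hkn, hkc⟩ := hc c hcn
    refine ⟨k, by omega, ?_⟩
    rw [← hvert _ _ _ (by omega), hsnoc, hkc]

theorem card_rainbowSimplices {n N : ℕ} (hN : 0 < N) {l : (Fin n → ℕ) → ℕ}
    (h : IsSpernerColoring n N l) : ((rainbowSimplices n N l).card : ZMod 2) = 1 := by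
  induction n with
  | zero =>
    have : rainbowSimplices 0 N l = Finset.univ := by
      ext s
      simp only [rainbowSimplices, Finset.mem_filter, Finset.mem_product, Fintype.mem_piFinset,
        Finset.mem_univ, and_true, iff_true]
      refine ⟨fun i => i.elim0, fun c hc => ⟨0, le_rfl, ?_⟩⟩
      have := h.le (kuhnVertex s.1 s.2 0)
      omega
    rw [this]
    simp
  | succ n ih =>
    classical
    rw [card_rainbowSimplices_eq_sum n N l h.le, Finset.sum_range_succ, Finset.sum_range_succ',
      Finset.sum_eq_zero fun j hj => card_rainbowFacets_of_interior n N l j (by simpa using hj),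
      zero_add, card_rainbowFacets_zero h,
      ← Finset.card_filter_add_card_filter_not (s := rainbowFacets n N l (n + 1))
        (fun s => s.1 (s.2.symm (Fin.last n)) ≠ 0), card_rainbowFacets_last hN h]
    push_cast
    rw [ih h.snoc, ← add_assoc, CharTwo.add_self_eq_zero, zero_add]

/-! ### The Lebesgue covering theorem -/

/-- The point of the cube obtained by rescaling a point of the grid `{0, …, N}ⁿ`. -/
noncomputable def gridPoint (N : ℕ) {n : ℕ} (v : Fin n → ℕ) : Fin n → unitInterval :=
  fun i => Set.projIcc 0 1 zero_le_one ((v i : ℝ) / N)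

lemma dist_gridPoint_kuhnVertex_le {N n : ℕ} (v : Fin n → ℕ) (τ : Equiv.Perm (Fin n)) (k : ℕ) :
    dist (gridPoint N v) (gridPoint N (kuhnVertex v τ k)) ≤ 1 / N := by
  refine (dist_pi_le_iff (by positivity)).2 fun i => ?_
  rw [Subtype.dist_eq, Real.dist_eq]
  refine (Set.abs_projIcc_sub_projIcc _).trans ?_
  rw [← sub_div, abs_div, Nat.abs_cast]
  gcongr
  simp only [kuhnVertex]
  split_ifs <;> simp

theorem exists_mem_of_cube_cover_fin {n : ℕ} {ι : Type*} [Finite ι]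
    (U : ι → Set (Fin n → unitInterval)) (hU : ∀ b, IsOpen (U b)) (hcov : ∀ x, ∃ b, x ∈ U b)
    (hface : ∀ b i, ∀ x ∈ U b, ∀ y ∈ U b, x i = 0 → y i ≠ 1) :
    ∃ x, n + 1 ≤ {b | x ∈ U b}.ncard := by
  classical
  obtain ⟨δ, hδ, hball⟩ := lebesgue_number_lemma_of_metric (isCompact_univ) hU
    (fun x _ => Set.mem_iUnion.2 (hcov x))
  obtain ⟨N, hN⟩ := exists_nat_one_div_lt hδ
  have hN' : (1 : ℝ) / (N + 1 : ℕ) < δ := by exact_mod_cast hN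
  choose b hb using fun v : Fin n → ℕ => hball (gridPoint (N + 1) v) (Set.mem_univ _)
  have hbmem : ∀ v, gridPoint (N + 1) v ∈ U (b v) := fun v => hb v (Metric.mem_ball_self hδ)
  have hcol : ∀ b, ∃ c ≤ n, (∀ i : Fin n, (∃ y ∈ U b, y i = 0) → c ≤ i) ∧
      ∀ i : Fin n, (i : ℕ) = c → ∃ y ∈ U b, y i = 0 := fun b => by
    by_cases h : ∃ c : ℕ, ∃ i : Fin n, (i : ℕ) = c ∧ ∃ y ∈ U b, y i = 0
    · obtain ⟨i, hi, hy⟩ := Nat.find_spec h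
      refine ⟨Nat.find h, by omega, fun j hj => Nat.find_min' h ⟨j, rfl, hj⟩, fun j hj => ?_⟩
      rwa [Fin.ext (hj.trans hi.symm)]
    · push Not at h
      exact ⟨n, le_rfl, fun i ⟨y, hy, hyi⟩ => (h i i rfl y hy hyi).elim, fun i hi => by omega⟩
  choose c hcn hc0 hc using hcol
  have hsp : IsSpernerColoring n (N + 1) fun v => c (b v) := by
    refine ⟨fun v => hcn _, fun v i hi => hc0 _ i ⟨_, hbmem v, ?_⟩, fun v i hi heq => ?_⟩
    · simp [gridPoint, hi]
    · obtain ⟨y, hy, hyi⟩ := hc (b v) i heq.symm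
      refine hface _ i y hy _ (hbmem v) hyi ?_
      have : ((N : ℝ) + 1) ≠ 0 := by positivity
      simp [gridPoint, hi, this]
  have hne : (rainbowSimplices n (N + 1) fun v => c (b v)).Nonempty := by
    rw [← Finset.card_ne_zero]
    intro h0
    have := card_rainbowSimplices N.succ_pos hsp
    simp [h0] at this
  obtain ⟨⟨v, τ⟩, hs⟩ := hne
  have hs := (Finset.mem_filter.1 hs).2
  choose k hkn hk using fun j : Fin (n + 1) => hs j (Nat.lt_succ_iff.1 j.2)
  refine ⟨gridPoint (N + 1) v, ?_⟩
  have hinj : Function.Injective fun j => b (kuhnVertex v τ (k j)) := fun j j' h => by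
    have := congrArg c h
    simp only [hk] at this
    exact Fin.ext this
  calc n + 1 = (Set.range fun j => b (kuhnVertex v τ (k j))).ncard := by
        rw [← Set.image_univ, Set.ncard_image_of_injective _ hinj, Set.ncard_univ]; simp
    _ ≤ _ := Set.ncard_le_ncard (by
        rintro _ ⟨j, rfl⟩
        exact hb _ (Metric.mem_ball.2
          ((dist_gridPoint_kuhnVertex_le v τ (k j)).trans_lt hN'))) (Set.toFinite _)

/-- The Lebesgue covering theorem: a finite open cover of a cube none of whose members meets
two opposite faces has order at least the dimension of the cube. -/
theorem exists_mem_of_cube_cover {κ ι : Type*} [Fintype κ] [Finite ι]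
    (U : ι → Set (κ → unitInterval)) (hU : ∀ b, IsOpen (U b)) (hcov : ∀ x, ∃ b, x ∈ U b)
    (hface : ∀ b i, ∀ x ∈ U b, ∀ y ∈ U b, x i = 0 → y i ≠ 1) :
    ∃ x, Fintype.card κ + 1 ≤ {b | x ∈ U b}.ncard := by
  let e := Fintype.equivFin κ
  obtain ⟨x, hx⟩ := exists_mem_of_cube_cover_fin (fun b => (fun x k => x (e k)) ⁻¹' U b)
    (fun b => (hU b).preimage (by fun_prop)) (fun x => hcov _)
    (fun b i x hx y hy h => by
      have := hface b (e.symm i) _ hx _ hy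
      simp at this
      exact this h)
  exact ⟨_, hx⟩

/-! ### Algebras of recurrent sets -/

/-- A translation invariant Boolean algebra of subsets of a group which separates points and
all of whose nonempty members are syndetic (return times sets to clopen sets in a free minimal
zero-dimensional system). -/
structure RecurrentAlgebra (G : Type*) [Group G] where
  carrier : Set (Set G)
  compl_mem : ∀ A ∈ carrier, Aᶜ ∈ carrier
  inter_mem : ∀ A ∈ carrier, ∀ B ∈ carrier, A ∩ B ∈ carrier
  univ_mem : Set.univ ∈ carrier
  translate_mem : ∀ A ∈ carrier, ∀ g : G, {h | g * h ∈ A} ∈ carrier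
  syndetic : ∀ A ∈ carrier, A.Nonempty → ∃ L : Finset G, ∀ c, ∃ l ∈ L, l * c ∈ A
  separates : ∀ g h : G, g ≠ h → ∃ A ∈ carrier, g ∈ A ∧ h ∉ A

lemma exists_maximal_invariant_filter (G : Type*) [Group G] :
    ∃ f : Filter G, (f.NeBot ∧ ∀ g : G, Tendsto (g * ·) f f) ∧
      ∀ f' : Filter G, f'.NeBot → (∀ g : G, Tendsto (g * ·) f' f') → f' ≤ f → f ≤ f' := by
  obtain ⟨f, hf⟩ := zorn_le₀ (α := (Filter G)ᵒᵈ)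
    {f | (OrderDual.ofDual f).NeBot ∧
      ∀ g : G, Tendsto (g * ·) (OrderDual.ofDual f) (OrderDual.ofDual f)} (fun c hc hchain => by
      rcases c.eq_empty_or_nonempty with rfl | hne
      · exact ⟨OrderDual.toDual ⊤, ⟨inferInstanceAs (⊤ : Filter G).NeBot, fun g => tendsto_top⟩,
          by simp⟩
      have hdir : DirectedOn (· ≥ ·) (OrderDual.toDual ⁻¹' c : Set (Filter G)) :=
        fun a ha b hb => by
          rcases hchain.total ha hb with h | h
          · exact ⟨b, hb, h, le_rfl⟩
          · exact ⟨a, ha, le_rfl, h⟩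
      have hne' : (OrderDual.toDual ⁻¹' c : Set (Filter G)).Nonempty := hne
      refine ⟨OrderDual.toDual (sInf (OrderDual.toDual ⁻¹' c)), ⟨?_, fun g => ?_⟩,
        fun z hz => sInf_le (α := Filter G) hz⟩
      · exact Filter.sInf_neBot_of_directed' hne' hdir fun h => (hc h).1.ne rfl
      · refine le_sInf fun a ha => ?_
        exact ((hc ha).2 g).mono_left (sInf_le (α := Filter G) ha))
  exact ⟨OrderDual.ofDual f, hf.1, fun f' h1 h2 h3 => hf.2 (y := OrderDual.toDual f') ⟨h1, h2⟩ h3⟩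

/-- Katětov's three-set lemma for a left translation. -/
lemma exists_three_sets (w : G) (hw : w ≠ 1) :
    ∃ A : Set G, (∀ x ∈ A, w * x ∉ A) ∧ ∀ x, x ∈ A ∨ w⁻¹ * x ∈ A ∨ w * x ∈ A := by
  obtain ⟨A, hA⟩ := zorn_subset {A : Set G | ∀ x ∈ A, w * x ∉ A} (fun c hc hchain =>
    ⟨⋃₀ c, fun x ⟨a, ha, hxa⟩ ⟨b, hb, hxb⟩ => by
      rcases hchain.total ha hb with h | h
      · exact hc hb x (h hxa) hxb
      · exact hc ha x hxa (h hxb), fun s hs => Set.subset_sUnion_of_mem hs⟩)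
  refine ⟨A, hA.1, fun x => ?_⟩
  by_contra! h
  refine h.1 (hA.2 (y := insert x A) ?_ (Set.subset_insert _ _) (Set.mem_insert _ _))
  rintro y (rfl | hy) (h' | h')
  · exact hw (by simpa using h')
  · exact h.2.2 h'
  · exact h.2.1 (by rw [← h']; simpa using hy)
  · exact hA.1 y hy h'

theorem exists_recurrentAlgebra (G : Type*) [Group G] : Nonempty (RecurrentAlgebra G) := by
  obtain ⟨f, ⟨hne, hinv⟩, hmax⟩ := exists_maximal_invariant_filter G
  let U : Ultrafilter G := Ultrafilter.of f
  have hU : ∀ s ∈ f, s ∈ U := fun s hs => Ultrafilter.of_le f hs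
  refine ⟨{
    carrier := Set.range fun S : Set G => {g | {h | g * h ∈ S} ∈ U}
    compl_mem := ?_
    inter_mem := ?_
    univ_mem := ⟨Set.univ, Set.eq_univ_of_forall fun _ => Filter.univ_mem (f := (U : Filter G))⟩
    translate_mem := ?_
    syndetic := ?_
    separates := ?_ }⟩
  · rintro _ ⟨S, rfl⟩
    refine ⟨Sᶜ, ?_⟩
    ext g
    exact Ultrafilter.compl_mem_iff_notMem (f := U) (s := {h | g * h ∈ S})
  · rintro _ ⟨S, rfl⟩ _ ⟨T, rfl⟩
    refine ⟨S ∩ T, ?_⟩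
    ext g
    exact Filter.inter_mem_iff (f := (U : Filter G)) (s := {h | g * h ∈ S}) (t := {h | g * h ∈ T})
  · rintro _ ⟨S, rfl⟩ g
    refine ⟨{h | g * h ∈ S}, ?_⟩
    ext h
    simp [mul_assoc]
  · rintro _ ⟨S, rfl⟩ ⟨g₀, hg₀⟩
    let f' : Filter G := f ⊓ ⨅ g : G, 𝓟 {h | g * h ∉ S}
    have hf'inv : ∀ g : G, Tendsto (g * ·) f' f' := fun g =>
      tendsto_inf.2 ⟨(hinv g).mono_left inf_le_left, tendsto_iInf.2 fun a => tendsto_principal.2 <|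
        Filter.mem_of_superset (Filter.mem_inf_of_right
          (Filter.mem_iInf_of_mem (a * g) (Filter.mem_principal_self _))) fun h hh => by
            simpa [mul_assoc] using hh⟩
    have hbot : f' = ⊥ := by
      by_contra hbot
      have h1 : {h | g₀ * h ∉ S} ∈ f := hmax f' ⟨hbot⟩ hf'inv inf_le_left <|
        Filter.mem_inf_of_right (Filter.mem_iInf_of_mem g₀ (Filter.mem_principal_self _))
      exact (Ultrafilter.compl_mem_iff_notMem (f := U)).1 (hU _ h1) hg₀
    obtain ⟨A, hA, B, hB, hAB⟩ := Filter.inf_eq_bot_iff.1 hbot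
    obtain ⟨L, hL⟩ := Filter.mem_iInf_finite _ |>.1 hB
    rw [Filter.iInf_principal_finset, Filter.mem_principal] at hL
    refine ⟨L, fun c => ?_⟩
    by_contra! hc
    have h1 : {h | c * h ∈ A} ∈ U := hU _ (hinv c hA)
    have h2 : ⋂ l ∈ L, {h | l * c * h ∉ S} ∈ (U : Filter G) := by
      rw [Filter.biInter_finset_mem]
      exact fun l hl => (Ultrafilter.compl_mem_iff_notMem (f := U)).2 (hc l hl)
    obtain ⟨x, hxA, hxB⟩ := Filter.nonempty_of_mem (Filter.inter_mem h1 h2)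
    have : c * x ∈ A ∩ B := ⟨hxA, hL (by
      simp only [Set.mem_iInter] at hxB ⊢
      exact fun l hl => by simpa [mul_assoc] using hxB l hl)⟩
    rw [hAB] at this
    exact this
  · intro g h hgh
    obtain ⟨A, hA1, hA2⟩ := exists_three_sets (h * g⁻¹) (fun h' => hgh (by
      rw [mul_inv_eq_one] at h'; exact h'.symm))
    have key : ∀ B : Set G, (∀ x ∈ B, h * g⁻¹ * x ∉ B) → {x | g * x ∈ B} ∈ U →
        ∃ A ∈ Set.range fun S : Set G => {g | {h | g * h ∈ S} ∈ U}, g ∈ A ∧ h ∉ A := by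
      intro B hB hgB
      refine ⟨_, ⟨B, rfl⟩, hgB, fun hhB => ?_⟩
      obtain ⟨x, hx1, hx2⟩ := Filter.nonempty_of_mem (Filter.inter_mem hgB hhB)
      exact hB _ hx1 (by simpa [mul_assoc] using hx2)
    have hcov : {x | g * x ∈ A} ∪ ({x | (h * g⁻¹)⁻¹ * (g * x) ∈ A} ∪
        {x | (h * g⁻¹) * (g * x) ∈ A}) ∈ U :=
      Filter.mem_of_superset Filter.univ_mem fun x _ => hA2 (g * x)
    rcases Ultrafilter.union_mem_iff.1 hcov with hU | hU
    · exact key A hA1 hU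
    rcases Ultrafilter.union_mem_iff.1 hU with hU | hU
    · refine key {x | (h * g⁻¹)⁻¹ * x ∈ A} (fun x hx hx' => hA1 _ hx ?_) hU
      simpa [mul_assoc] using hx'
    · refine key {x | (h * g⁻¹) * x ∈ A} (fun x hx hx' => hA1 _ hx hx') hU

/-! ### Uniform upper density -/

open Classical in
/-- The number of elements of the right translate `F c` lying in `E`. -/
noncomputable def visitCount (E : Set G) (F : Finset G) (c : G) : ℕ :=
  (F.filter fun f => f * c ∈ E).card

/-- The uniform upper density of `E` is at most `t`, as witnessed by a single finite window. -/
def DensityLE (E : Set G) (t : ℝ) : Prop :=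
  ∃ F : Finset G, F.Nonempty ∧ ∀ c, (visitCount E F c : ℝ) ≤ t * F.card

/-- The uniform upper density of `E` is larger than `t`. -/
def DensityGT (E : Set G) (t : ℝ) : Prop := ∃ s, t < s ∧ ¬ DensityLE E s

lemma visitCount_le_of_imp {E E' : Set G} {F : Finset G} {c : G}
    (h : ∀ f ∈ F, f * c ∈ E → f * c ∈ E') : visitCount E F c ≤ visitCount E' F c := by
  classical
  refine Finset.card_le_card fun f hf => ?_
  rw [Finset.mem_filter] at hf ⊢
  exact ⟨hf.1, h f hf.1 hf.2⟩

lemma visitCount_mono {E E' : Set G} (h : E ⊆ E') (F : Finset G) (c : G) :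
    visitCount E F c ≤ visitCount E' F c :=
  visitCount_le_of_imp fun _ _ hf => h hf

lemma visitCount_union_le (E E' : Set G) (F : Finset G) (c : G) :
    visitCount (E ∪ E') F c ≤ visitCount E F c + visitCount E' F c := by
  classical
  unfold visitCount
  simp only [Set.mem_union, Finset.filter_or]
  exact Finset.card_union_le _ _

lemma DensityLE.mono {E E' : Set G} {t t' : ℝ} (h : DensityLE E t) (hE : E' ⊆ E) (ht : t ≤ t') :
    DensityLE E' t' := by
  obtain ⟨F, hF, hc⟩ := h
  refine ⟨F, hF, fun c => ?_⟩
  have := visitCount_mono hE F c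
  calc (visitCount E' F c : ℝ) ≤ visitCount E F c := by exact_mod_cast this
    _ ≤ t * F.card := hc c
    _ ≤ _ := by gcongr

lemma DensityLE.translate {E : Set G} {t : ℝ} (h : DensityLE E t) (g : G) :
    DensityLE {h | g * h ∈ E} t := by
  classical
  obtain ⟨F, hF, hc⟩ := h
  refine ⟨F.image (g⁻¹ * ·), hF.image _, fun c => ?_⟩
  rw [Finset.card_image_of_injective _ (mul_right_injective _)]
  convert hc c using 2
  unfold visitCount
  rw [Finset.filter_image, Finset.card_image_of_injective _ (mul_right_injective _)]
  simp [mul_assoc]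

lemma IsFolnerSeq.eventually_card_le {Fo : ℕ → Finset G} (hFo : IsFolnerSeq G Fo) (g : G)
    {ε : ℝ} (hε : 0 < ε) [DecidableEq G] :
    ∀ᶠ n in atTop, (((Fo n).filter fun b => g * b ∉ Fo n).card : ℝ) ≤ ε * (Fo n).card := by
  filter_upwards [(hFo.2 g⁻¹).eventually (gt_mem_nhds hε)] with n hn
  have hpos : (0 : ℝ) < (Fo n).card := by exact_mod_cast (hFo.1 n).card_pos
  rw [div_lt_iff₀ hpos] at hn
  refine le_trans ?_ hn.le
  rw [← Set.ncard_coe_finset]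
  have h : (((Fo n).filter fun b => g * b ∉ Fo n : Finset G) : Set G).ncard ≤
      (symmDiff (g⁻¹ • (Fo n : Set G)) (Fo n : Set G)).ncard := by
    refine Set.ncard_le_ncard (fun b hb => ?_)
      (Set.Finite.symmDiff ((Fo n).finite_toSet.smul_set) (Fo n).finite_toSet)
    rw [Finset.mem_coe, Finset.mem_filter] at hb
    exact Or.inr ⟨hb.1, fun h => hb.2 (by simpa [Set.mem_smul_set_iff_inv_smul_mem] using h)⟩
  exact Nat.cast_le.2 h

lemma IsFolnerSeq.eventually_card_mul_sdiff_le {Fo : ℕ → Finset G} (hFo : IsFolnerSeq G Fo)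
    (W : Finset G) {ε : ℝ} (hε : 0 < ε) [DecidableEq G] :
    ∀ᶠ n in atTop, (((W * Fo n) \ Fo n).card : ℝ) ≤ ε * (Fo n).card := by
  have hδ : 0 < ε / (W.card + 1) := by positivity
  have h : ∀ᶠ n in atTop, ∀ w ∈ W,
      (((Fo n).filter fun b => w * b ∉ Fo n).card : ℝ) ≤ ε / (W.card + 1) * (Fo n).card :=
    (Filter.eventually_all_finset W).2 fun w _ => hFo.eventually_card_le w hδ
  filter_upwards [h] with n hn
  have hsub : (W * Fo n) \ Fo n ⊆
      W.biUnion fun w => ((Fo n).filter fun b => w * b ∉ Fo n).image (w * ·) := by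
    intro x hx
    obtain ⟨hx1, hx2⟩ := Finset.mem_sdiff.1 hx
    obtain ⟨w, hw, b, hb, rfl⟩ := Finset.mem_mul.1 hx1
    exact Finset.mem_biUnion.2 ⟨w, hw, Finset.mem_image.2 ⟨b, by simp [hb, hx2], rfl⟩⟩
  calc (((W * Fo n) \ Fo n).card : ℝ)
      ≤ ∑ w ∈ W, (((Fo n).filter fun b => w * b ∉ Fo n).card : ℝ) := by
        exact_mod_cast (Finset.card_le_card hsub).trans (Finset.card_biUnion_le.trans
          (Finset.sum_le_sum fun w _ => Finset.card_image_le))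
    _ ≤ ∑ w ∈ W, ε / (W.card + 1) * (Fo n).card := Finset.sum_le_sum hn
    _ = (W.card / (W.card + 1) : ℝ) * (ε * (Fo n).card) := by
        rw [Finset.sum_const, nsmul_eq_mul]; ring
    _ ≤ 1 * (ε * (Fo n).card) := by
        gcongr
        rw [div_le_one (by positivity)]
        linarith
    _ = _ := one_mul _

lemma card_mul_visitCount_le (E : Set G) (F F₀ : Finset G) (c : G) [DecidableEq G] :
    F₀.card * visitCount E F c ≤ ∑ a ∈ F, visitCount E F₀ (a * c) +
      ∑ f ∈ F₀, (F.filter fun b => f⁻¹ * b ∉ F).card := by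
  classical
  have hswap : ∑ a ∈ F, visitCount E F₀ (a * c) =
      ∑ f ∈ F₀, (F.filter fun a => f * (a * c) ∈ E).card := by
    simp only [visitCount, Finset.card_filter]
    exact Finset.sum_comm
  rw [hswap, ← Finset.sum_add_distrib, ← smul_eq_mul, ← Finset.sum_const]
  refine Finset.sum_le_sum fun f _ => ?_
  have hsub : (F.filter fun b => b * c ∈ E) ⊆
      (F.filter fun a => f * (a * c) ∈ E).image (f * ·) ∪ F.filter fun b => f⁻¹ * b ∉ F := by
    intro b hb
    rw [Finset.mem_filter] at hb
    by_cases h : f⁻¹ * b ∈ F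
    · exact Finset.mem_union_left _ (Finset.mem_image.2 ⟨f⁻¹ * b,
        by simp [h, ← mul_assoc, hb.2], by simp⟩)
    · exact Finset.mem_union_right _ (by simp [hb.1, h])
  exact (Finset.card_le_card hsub).trans ((Finset.card_union_le _ _).trans
    (Nat.add_le_add_right Finset.card_image_le _))

lemma DensityLE.eventually_visitCount_le {E : Set G} {t t' : ℝ} (h : DensityLE E t)
    (ht : t < t') {Fo : ℕ → Finset G} (hFo : IsFolnerSeq G Fo) :
    ∀ᶠ n in atTop, ∀ c, (visitCount E (Fo n) c : ℝ) ≤ t' * (Fo n).card := by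
  classical
  obtain ⟨F₀, hF₀, hc⟩ := h
  have hev : ∀ᶠ n in atTop, ∀ f ∈ F₀,
      (((Fo n).filter fun b => f⁻¹ * b ∉ Fo n).card : ℝ) ≤ (t' - t) * (Fo n).card :=
    (Filter.eventually_all_finset F₀).2 fun f _ => hFo.eventually_card_le f⁻¹ (sub_pos.2 ht)
  filter_upwards [hev] with n hn c
  have hpos : (0 : ℝ) < F₀.card := by exact_mod_cast hF₀.card_pos
  have h1 : (F₀.card * visitCount E (Fo n) c : ℝ) ≤ ∑ a ∈ Fo n, (visitCount E F₀ (a * c) : ℝ) +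
      ∑ f ∈ F₀, (((Fo n).filter fun b => f⁻¹ * b ∉ Fo n).card : ℝ) := by
    exact_mod_cast card_mul_visitCount_le E (Fo n) F₀ c
  have h2 : ∑ a ∈ Fo n, (visitCount E F₀ (a * c) : ℝ) ≤ ∑ a ∈ Fo n, t * F₀.card :=
    Finset.sum_le_sum fun a _ => hc _
  have h3 := Finset.sum_le_sum hn
  rw [Finset.sum_const, nsmul_eq_mul] at h2 h3
  refine le_of_mul_le_mul_left ?_ hpos
  calc _ ≤ _ := h1
    _ ≤ _ := add_le_add h2 h3
    _ = _ := by ring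

lemma DensityLE.union {E E' : Set G} {t t' r : ℝ} (hG : IsAmenable G) (h : DensityLE E t)
    (h' : DensityLE E' t') (hr : t + t' < r) : DensityLE (E ∪ E') r := by
  obtain ⟨Fo, hFo⟩ := hG
  obtain ⟨n, hn, hn'⟩ := ((h.eventually_visitCount_le (t' := t + (r - t - t') / 2) (by linarith)
    hFo).and (h'.eventually_visitCount_le (t' := t' + (r - t - t') / 2) (by linarith) hFo)).exists
  refine ⟨Fo n, hFo.1 n, fun c => ?_⟩
  have h1 : (visitCount (E ∪ E') (Fo n) c : ℝ) ≤ visitCount E (Fo n) c + visitCount E' (Fo n) c :=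
    by exact_mod_cast visitCount_union_le E E' (Fo n) c
  calc _ ≤ _ := h1
    _ ≤ _ := add_le_add (hn c) (hn' c)
    _ = _ := by ring

lemma DensityGT.exists_densityLE {E : Set G} {t : ℝ} (hG : IsAmenable G) (h : DensityGT E t) :
    ∃ δ > 0, ∀ E' V : Set G, DensityLE V δ → E ⊆ E' ∪ V → DensityGT E' t := by
  obtain ⟨s, hts, hs⟩ := h
  refine ⟨(s - t) / 3, by linarith, fun E' V hV hE => ⟨t + (s - t) / 3, by linarith, fun hE' => ?_⟩⟩
  exact hs ((hE'.union hG hV (r := s) (by linarith)).mono hE le_rfl)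

lemma DensityGT.exists_le_visitCount {E : Set G} {t : ℝ} (h : DensityGT E t) (F : Finset G) :
    ∃ c, t * F.card ≤ visitCount E F c := by
  rcases F.eq_empty_or_nonempty with rfl | hF
  · exact ⟨1, by simp⟩
  obtain ⟨s, hts, hs⟩ := h
  by_contra! hc
  exact hs ⟨F, hF, fun c => (hc c).le.trans (by gcongr)⟩

lemma densityGT_univ {t : ℝ} (ht : t < 1) : DensityGT (Set.univ : Set G) t := by
  refine ⟨(t + 1) / 2, by linarith, ?_⟩
  rintro ⟨F, hF, hc⟩
  have hpos : (0 : ℝ) < F.card := by exact_mod_cast hF.card_pos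
  have := hc 1
  simp [visitCount] at this
  nlinarith

namespace RecurrentAlgebra

variable (𝓑 : RecurrentAlgebra G)

lemma empty_mem : ∅ ∈ 𝓑.carrier := by simpa using 𝓑.compl_mem _ 𝓑.univ_mem

lemma union_mem {A B : Set G} (hA : A ∈ 𝓑.carrier) (hB : B ∈ 𝓑.carrier) : A ∪ B ∈ 𝓑.carrier := by
  have := 𝓑.compl_mem _ (𝓑.inter_mem _ (𝓑.compl_mem _ hA) _ (𝓑.compl_mem _ hB))
  rwa [Set.compl_inter, compl_compl, compl_compl] at this

lemma biInter_mem {ι : Type*} (s : Finset ι) {A : ι → Set G} (h : ∀ i ∈ s, A i ∈ 𝓑.carrier) :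
    ⋂ i ∈ s, A i ∈ 𝓑.carrier := by
  classical
  induction s using Finset.induction_on with
  | empty => simpa using 𝓑.univ_mem
  | insert i s _ ih =>
    rw [Finset.set_biInter_insert]
    exact 𝓑.inter_mem _ (h i (by simp)) _ (ih fun j hj => h j (by simp [hj]))

/-- Every point has a member of the algebra of small density around it, avoiding a given
finite set. -/
lemma exists_small_mem [Infinite G] (g : G) (Q : Finset G) (hg : g ∉ Q) {δ : ℝ} (hδ : 0 < δ) :
    ∃ V ∈ 𝓑.carrier, g ∈ V ∧ (∀ q ∈ Q, q ∉ V) ∧ DensityLE V δ := by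
  classical
  obtain ⟨m, hm⟩ := exists_nat_one_div_lt hδ
  obtain ⟨F, hF⟩ := Infinite.exists_subset_card_eq G (m + 1)
  have hsep : ∀ h, h ≠ g → ∃ A ∈ 𝓑.carrier, g ∈ A ∧ h ∉ A := fun h hh => 𝓑.separates g h hh.symm
  choose! A hA hgA hhA using hsep
  let D : Finset G := (F * F⁻¹).erase 1
  have hD : ∀ d ∈ D, d * g ≠ g := fun d hd h => by simp [D] at hd; exact hd.1 (by simpa using h)
  refine ⟨(⋂ q ∈ Q, A q) ∩ ⋂ d ∈ D, (A (d * g) ∩ {x | d * x ∈ A (d * g)}ᶜ), ?_, ?_, ?_, F, ?_, ?_⟩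
  · refine 𝓑.inter_mem _ (𝓑.biInter_mem _ fun q hq => hA q fun h => hg (h ▸ hq)) _
      (𝓑.biInter_mem _ fun d hd => ?_)
    have := hA _ (hD d hd)
    exact 𝓑.inter_mem _ this _ (𝓑.compl_mem _ (𝓑.translate_mem _ this d))
  · simp only [Set.mem_inter_iff, Set.mem_iInter]
    refine ⟨fun q hq => hgA q fun h => hg (h ▸ hq), fun d hd => ⟨hgA _ (hD d hd), ?_⟩⟩
    exact hhA _ (hD d hd)
  · intro q hq h
    simp only [Set.mem_inter_iff, Set.mem_iInter] at h
    exact hhA q (fun h => hg (h ▸ hq)) (h.1 q hq)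
  · rw [← Finset.card_pos, hF]; omega
  · intro c
    have h1 : visitCount ((⋂ q ∈ Q, A q) ∩
        ⋂ d ∈ D, (A (d * g) ∩ {x | d * x ∈ A (d * g)}ᶜ)) F c ≤ 1 := by
      refine Finset.card_le_one.2 fun a ha b hb => ?_
      simp only [Finset.mem_filter, Set.mem_inter_iff, Set.mem_iInter] at ha hb
      by_contra hab
      have hd : b * a⁻¹ ∈ D := by
        simp only [D, Finset.mem_erase]
        exact ⟨fun h => hab (mul_inv_eq_one.1 h).symm,
          Finset.mul_mem_mul hb.1 (Finset.inv_mem_inv ha.1)⟩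
      refine (ha.2.2 _ hd).2 ?_
      have := (hb.2.2 _ hd).1
      simpa [mul_assoc] using this
    rw [hF]
    push_cast
    calc (visitCount _ F c : ℝ) ≤ 1 := by exact_mod_cast h1
      _ ≤ δ * (m + 1) := by
        rw [div_lt_iff₀ (by positivity)] at hm
        exact hm.le

/-- The group is covered by finitely many members of the algebra of small density. -/
lemma exists_small_cover [Infinite G] {δ : ℝ} (hδ : 0 < δ) :
    ∃ (V : Set G) (L : Finset G), V ∈ 𝓑.carrier ∧ DensityLE V δ ∧ 1 ∈ V ∧
      ∀ c, ∃ l ∈ L, l * c ∈ V := by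
  obtain ⟨V, hV, h1, -, hd⟩ := 𝓑.exists_small_mem 1 ∅ (by simp) hδ
  obtain ⟨L, hL⟩ := 𝓑.syndetic V hV ⟨1, h1⟩
  exact ⟨V, L, hV, hd, h1, hL⟩

end RecurrentAlgebra

/-! ### Partial configurations -/

/-- The partial configuration `u'` extends `u` and agrees with it on `Q`. -/
def ExtendsFixing {S α : Type*} (Q : Set S) (u u' : S → Option α) : Prop :=
  (∀ g a, u g = some a → u' g = some a) ∧ ∀ g ∈ Q, u' g = u g

lemma ExtendsFixing.trans {S α : Type*} {Q Q' : Set S} {u u' u'' : S → Option α}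
    (h : ExtendsFixing Q u u') (h' : ExtendsFixing Q' u' u'') (hQ : Q ⊆ Q') :
    ExtendsFixing Q u u'' :=
  ⟨fun g a hg => h'.1 g a (h.1 g a hg), fun g hg => (h'.2 g (hQ hg)).trans (h.2 g hg)⟩

lemma ExtendsFixing.refl {S α : Type*} (Q : Set S) (u : S → Option α) : ExtendsFixing Q u u :=
  ⟨fun _ _ h => h, fun _ _ => rfl⟩

open Classical in
/-- Give the value `a` to all the undefined sites in `V`. -/
noncomputable def fillOn {S α : Type*} (u : S → Option α) (V : Set S) (a : α) : S → Option α :=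
  fun g => if g ∈ V ∧ u g = none then some a else u g

section fillOn

variable {S α : Type*} {u : S → Option α} {V Q : Set S} {a : α}

lemma extendsFixing_fillOn (h : ∀ q ∈ Q, q ∉ V) : ExtendsFixing Q u (fillOn u V a) :=
  ⟨fun g b hg => by simp [fillOn, hg], fun g hg => by simp [fillOn, h g hg]⟩

lemma fillOn_eq_none {g : S} : fillOn u V a g = none ↔ u g = none ∧ g ∉ V := by
  unfold fillOn
  split_ifs with h
  · simp [h.1]
  · simp only [not_and] at h
    exact ⟨fun hu => ⟨hu, fun hg => h hg hu⟩, fun hu => hu.1⟩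

lemma fillOn_of_mem {g : S} (hg : g ∈ V) : fillOn u V a g = some ((u g).getD a) := by
  unfold fillOn
  rcases hu : u g with _ | b <;> simp [hg]

end fillOn

/-- A partial configuration is admissible if it is measurable with respect to a recurrent algebra,
takes finitely many values and is undefined on a set of uniform upper density larger than `θ`. -/
structure IsAdmissible {α : Type*} (𝓑 : RecurrentAlgebra G) (θ : ℝ) (u : G → Option α) :
    Prop where
  fiber_mem : ∀ p, {g | u g = p} ∈ 𝓑.carrier
  finite_range : (Set.range u).Finite
  densityGT : DensityGT {g | u g = none} θ

section

variable {α : Type*} {𝓑 : RecurrentAlgebra G} {θ : ℝ} {u : G → Option α}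

lemma IsAdmissible.fillOn (hu : IsAdmissible 𝓑 θ u) {V : Set G} (a : α) (hV : V ∈ 𝓑.carrier)
    (hd : DensityGT ({g | u g = none} \ V) θ) : IsAdmissible 𝓑 θ (fillOn u V a) where
  fiber_mem p := by
    rcases p with _ | b
    · simp only [fillOn_eq_none]
      exact 𝓑.inter_mem _ (hu.fiber_mem none) _ (𝓑.compl_mem _ hV)
    · by_cases hb : b = a
      · subst hb
        convert 𝓑.union_mem (hu.fiber_mem (some b)) (𝓑.inter_mem _ hV _ (hu.fiber_mem none)) using 1
        ext g
        by_cases h : g ∈ V <;> rcases h' : u g with _ | c <;> simp [_root_.fillOn, h, h']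
      · convert hu.fiber_mem (some b) using 1
        ext g
        by_cases h : g ∈ V <;> rcases h' : u g with _ | c <;>
          simp [_root_.fillOn, h, h', Ne.symm hb]
  finite_range := by
    refine (hu.finite_range.insert (some a)).subset ?_
    rintro _ ⟨g, rfl⟩
    unfold _root_.fillOn
    split_ifs
    · exact Set.mem_insert _ _
    · exact Set.mem_insert_of_mem _ ⟨g, rfl⟩
  densityGT := by
    simp only [fillOn_eq_none]
    exact hd

variable [Infinite G]

/-- Finitely many undefined sites can be given prescribed values. -/
lemma IsAdmissible.exists_extendsFixing_finset (hG : IsAmenable G) (hu : IsAdmissible 𝓑 θ u)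
    (v : G → α) (Y Q : Finset G) (hQ : Disjoint Y Q) :
    ∃ u', IsAdmissible 𝓑 θ u' ∧ ExtendsFixing (Q : Set G) u u' ∧
      ∀ y ∈ Y, u' y = some ((u y).getD (v y)) := by
  classical
  induction Y using Finset.induction_on generalizing Q with
  | empty => exact ⟨u, hu, .refl _ _, by simp⟩
  | insert y Y hy ih =>
    rw [Finset.disjoint_insert_left] at hQ
    obtain ⟨u₁, hu₁, he, hv⟩ := ih (insert y Q) (Finset.disjoint_insert_right.2 ⟨hy, hQ.2⟩)
    obtain ⟨δ, hδ, hd⟩ := hu₁.densityGT.exists_densityLE hG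
    obtain ⟨V, hV, hyV, hVQ, hVδ⟩ := 𝓑.exists_small_mem y Q hQ.1 hδ
    have hext : ExtendsFixing (Q : Set G) u₁ (_root_.fillOn u₁ V (v y)) :=
      extendsFixing_fillOn fun q hq => hVQ q hq
    refine ⟨_root_.fillOn u₁ V (v y), hu₁.fillOn _ hV (hd _ V hVδ (by simp)),
      ExtendsFixing.trans ⟨he.1, fun g hg => he.2 g (by simp_all)⟩ hext subset_rfl, ?_⟩
    intro z hz
    rcases Finset.mem_insert.1 hz with rfl | hz
    · rw [fillOn_of_mem hyV, he.2 z (by simp)]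
    · exact hext.1 _ _ (hv z hz)

lemma RecurrentAlgebra.not_finite {A : Set G} (hA : A ∈ 𝓑.carrier) (h : A.Nonempty) :
    ¬ A.Finite := by
  intro hf
  obtain ⟨L, hL⟩ := 𝓑.syndetic A hA h
  refine Set.infinite_univ (α := G) (((L.finite_toSet.inv).mul hf).subset fun c _ => ?_)
  obtain ⟨l, hl, hlc⟩ := hL c
  exact ⟨l⁻¹, by simpa using hl, l * c, hlc, by simp⟩

/-- Any pattern compatible with the values already chosen near the identity can be inserted. -/
lemma IsAdmissible.exists_pattern (hG : IsAmenable G) (hu : IsAdmissible 𝓑 θ u)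
    (Q K : Finset G) (p : G → α) :
    ∃ u', IsAdmissible 𝓑 θ u' ∧ ExtendsFixing (Q : Set G) u u' ∧
      ∃ t, ∀ k ∈ K, u' (k * t) = some ((u k).getD (p k)) := by
  classical
  have hN : (⋂ k ∈ K, {t | k * t ∈ {g | u g = u k}}) ∈ 𝓑.carrier :=
    𝓑.biInter_mem _ fun k _ => 𝓑.translate_mem _ (hu.fiber_mem _) k
  obtain ⟨t, htN, htQ⟩ := (Set.not_subset (t := ((K⁻¹ * Q : Finset G) : Set G))).1 fun h =>
    RecurrentAlgebra.not_finite hN ⟨1, by simp⟩ ((Finset.finite_toSet _).subset h)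
  simp only [Set.mem_iInter, Set.mem_ofPred_eq] at htN
  obtain ⟨u', hu', he, hv⟩ := hu.exists_extendsFixing_finset hG (fun y => p (y * t⁻¹))
    (K.image (· * t)) Q (Finset.disjoint_left.2 fun x hx hxQ => by
      obtain ⟨k, hk, rfl⟩ := Finset.mem_image.1 hx
      exact htQ (Finset.mem_mul.2 ⟨k⁻¹, Finset.inv_mem_inv hk, k * t, hxQ, by simp⟩))
  refine ⟨u', hu', he, t, fun k hk => ?_⟩
  rw [hv _ (Finset.mem_image_of_mem _ hk), htN k hk]
  simp

lemma RecurrentAlgebra.exists_small_superset (𝓑 : RecurrentAlgebra G) (hG : IsAmenable G)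
    (Q : Finset G) {ε : ℝ} (hε : 0 < ε) :
    ∃ V ∈ 𝓑.carrier, (∀ q ∈ Q, q ∈ V) ∧ DensityLE V ε := by
  classical
  induction Q using Finset.induction_on generalizing ε with
  | empty => exact ⟨∅, 𝓑.empty_mem, by simp, {1}, by simp, fun c => by simp [visitCount, hε.le]⟩
  | insert q Q _ ih =>
    obtain ⟨V, hV, hQ, hd⟩ := ih (ε := ε / 3) (by linarith)
    obtain ⟨V', hV', hq, -, hd'⟩ := 𝓑.exists_small_mem q ∅ (by simp) (δ := ε / 3) (by linarith)
    refine ⟨V ∪ V', 𝓑.union_mem hV hV', fun r hr => ?_, hd.union hG hd' (by linarith)⟩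
    rcases Finset.mem_insert.1 hr with rfl | hr
    · exact Or.inr hq
    · exact Or.inl (hQ r hr)

/-- The density of the set of undefined sites can be brought arbitrarily close to `θ`. -/
lemma IsAdmissible.exists_densityLE (hG : IsAmenable G) (hu : IsAdmissible 𝓑 θ u) (hθ : 0 ≤ θ)
    (Q : Finset G) {ε : ℝ} (hε : 0 < ε) (a : α) :
    ∃ u', IsAdmissible 𝓑 θ u' ∧ ExtendsFixing (Q : Set G) u u' ∧
      DensityLE {g | u' g = none} (θ + ε) := by
  classical
  obtain ⟨VQ, hVQ, hQ, hdQ⟩ := 𝓑.exists_small_superset hG Q hε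
  obtain ⟨V, L, hV, hd, -, hL⟩ := 𝓑.exists_small_cover (δ := ε / 3) (by linarith)
  have key : ∀ s : Finset G, ∃ u', IsAdmissible 𝓑 θ u' ∧ ExtendsFixing (Q : Set G) u u' ∧
      (DensityLE {g | u' g = none} (θ + ε) ∨
        ∀ l ∈ s, ∀ g, l * g ∈ V → u' g = none → g ∈ VQ) := by
    intro s
    induction s using Finset.induction_on with
    | empty => exact ⟨u, hu, .refl _ _, Or.inr (by simp)⟩
    | insert l s _ ih =>
      obtain ⟨u₁, hu₁, he, h | h⟩ := ih
      · exact ⟨u₁, hu₁, he, Or.inl h⟩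
      by_cases h' : DensityLE {g | u₁ g = none} (θ + ε)
      · exact ⟨u₁, hu₁, he, Or.inl h'⟩
      have hW := (hd.translate l).mono (E' := {g | l * g ∈ V} \ VQ) Set.sdiff_subset le_rfl
      refine ⟨_root_.fillOn u₁ ({g | l * g ∈ V} \ VQ) a,
        hu₁.fillOn a (𝓑.inter_mem _ (𝓑.translate_mem _ hV l) _ (𝓑.compl_mem _ hVQ))
          ⟨θ + ε / 2, by linarith, fun hE => h' ?_⟩,
        he.trans (extendsFixing_fillOn fun q hq hqV => hqV.2 (hQ q hq)) subset_rfl, Or.inr ?_⟩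
      · exact (hE.union hG hW (r := θ + ε) (by linarith)).mono (by simp) le_rfl
      · intro l' hl' g hg hn
        rw [fillOn_eq_none] at hn
        rcases Finset.mem_insert.1 hl' with rfl | hl'
        · by_contra hgQ
          exact hn.2 ⟨hg, hgQ⟩
        · exact h l' hl' g hg hn.1
  obtain ⟨u', hu', he, h | h⟩ := key L
  · exact ⟨u', hu', he, h⟩
  · refine ⟨u', hu', he, hdQ.mono (fun g hg => ?_) (by linarith)⟩
    obtain ⟨l, hl, hlg⟩ := hL g
    exact h l hl g hlg hg

/-- One stage of the construction. -/
lemma IsAdmissible.exists_stage (hG : IsAmenable G) (hu : IsAdmissible 𝓑 θ u) (hθ : 0 ≤ θ)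
    (Q K : Finset G) (p : G → α) {ε : ℝ} (hε : 0 < ε) (a : α) :
    ∃ (u' : G → Option α) (Q' : Finset G), IsAdmissible 𝓑 θ u' ∧ Q ⊆ Q' ∧
      ExtendsFixing (Q : Set G) u u' ∧ DensityLE {g | u' g = none} (θ + ε) ∧
      (∃ L : Finset G, ∀ c, ∃ l ∈ L, ∀ k ∈ K, u' (k * (l * c)) = some ((u k).getD (p k))) ∧
      ∃ c, (∀ k ∈ K, k * c ∈ Q') ∧ θ * K.card ≤ visitCount {g | u' g = none} K c := by
  classical
  obtain ⟨u₁, hu₁, he₁, t, ht⟩ := hu.exists_pattern hG Q K p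
  obtain ⟨u', hu', he, hd⟩ := hu₁.exists_densityLE hG hθ Q hε a
  obtain ⟨c, hc⟩ := hu'.densityGT.exists_le_visitCount K
  refine ⟨u', Q ∪ K.image (· * c), hu', Finset.subset_union_left, he₁.trans he subset_rfl, hd,
    ?_, c, fun k hk => Finset.mem_union_right _ (Finset.mem_image_of_mem _ hk), hc⟩
  have hN : (⋂ k ∈ K, {t | k * t ∈ {g | u' g = some ((u k).getD (p k))}}) ∈ 𝓑.carrier :=
    𝓑.biInter_mem _ fun k _ => 𝓑.translate_mem _ (hu'.fiber_mem _) k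
  obtain ⟨L, hL⟩ := 𝓑.syndetic _ hN ⟨t, by
    simp only [Set.mem_iInter, Set.mem_ofPred_eq]
    exact fun k hk => he.1 _ _ (ht k hk)⟩
  refine ⟨L, fun c => ?_⟩
  obtain ⟨l, hl, hlc⟩ := hL c
  simp only [Set.mem_iInter, Set.mem_ofPred_eq] at hlc
  exact ⟨l, hl, hlc⟩

end

/-- The sequence of partial configurations defining the minimal subshift. -/
lemma exists_partial_configurations [Infinite G] {α : Type*} [Nonempty α] (hG : IsAmenable G)
    {θ : ℝ} (hθ : 0 ≤ θ) (hθ1 : θ < 1) (K : ℕ → Finset G) (p : ℕ → G → α) :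
    ∃ u : ℕ → G → Option α, (∀ n, (Set.range (u n)).Finite) ∧
      (∀ m n g a, m ≤ n → u m g = some a → u n g = some a) ∧
      (∀ ε > 0, ∃ n, DensityLE {g | u n g = none} (θ + ε)) ∧
      (∀ n, ∃ L : Finset G, ∀ c, ∃ l ∈ L, ∀ k ∈ K n,
        u (n + 1) (k * (l * c)) = some ((u n k).getD (p n k))) ∧
      ∀ n, ∃ c, θ * (K n).card ≤ visitCount {g | ∀ m, u m g = none} (K n) c := by
  classical
  obtain ⟨𝓑⟩ := exists_recurrentAlgebra G
  obtain ⟨a⟩ := ‹Nonempty α›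
  have h0 : IsAdmissible 𝓑 θ (fun _ : G => (none : Option α)) := by
    refine ⟨fun p => ?_, (Set.finite_singleton none).subset (by rintro _ ⟨g, rfl⟩; rfl), ?_⟩
    · by_cases h : none = p
      · simpa [h] using 𝓑.univ_mem
      · simpa [h] using 𝓑.empty_mem
    · simpa using densityGT_univ hθ1
  let State := {s : (G → Option α) × Finset G // IsAdmissible 𝓑 θ s.1}
  have step : ∀ (n : ℕ) (s : State), ∃ s' : State, s.1.2 ⊆ s'.1.2 ∧
      ExtendsFixing (s.1.2 : Set G) s.1.1 s'.1.1 ∧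
      DensityLE {g | s'.1.1 g = none} (θ + 1 / (n + 1 : ℝ)) ∧
      (∃ L : Finset G, ∀ c, ∃ l ∈ L, ∀ k ∈ K n,
        s'.1.1 (k * (l * c)) = some ((s.1.1 k).getD (p n k))) ∧
      ∃ c, (∀ k ∈ K n, k * c ∈ s'.1.2) ∧
        θ * (K n).card ≤ visitCount {g | s'.1.1 g = none} (K n) c := by
    rintro n ⟨⟨u, Q⟩, hu⟩
    obtain ⟨u', Q', hu', h⟩ := IsAdmissible.exists_stage hG hu hθ Q (K n) (p n)
      (ε := 1 / (n + 1 : ℝ)) (by positivity) a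
    exact ⟨⟨⟨u', Q'⟩, hu'⟩, h⟩
  choose next hQ hext hdens hpat hcount using step
  let s : ℕ → State := fun n => Nat.rec ⟨⟨_, ∅⟩, h0⟩ next n
  have hs : ∀ n, s (n + 1) = next n (s n) := fun n => rfl
  have hQmono : Monotone fun n => (s n).1.2 := monotone_nat_of_le_succ fun n => hQ n (s n)
  have hE : ∀ m n, m ≤ n → ExtendsFixing ((s m).1.2 : Set G) (s m).1.1 (s n).1.1 := by
    intro m n hmn
    induction n, hmn using Nat.le_induction with
    | base => exact .refl _ _
    | succ n hmn ih => exact ih.trans (hext n (s n)) (by exact_mod_cast hQmono hmn)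
  refine ⟨fun n => (s n).1.1, fun n => (s n).2.finite_range,
    fun m n g b hmn => (hE m n hmn).1 g b, fun ε hε => ?_, fun n => hpat n (s n), fun n => ?_⟩
  · obtain ⟨n, hn⟩ := exists_nat_one_div_lt hε
    exact ⟨n + 1, (hdens n (s n)).mono subset_rfl (by linarith)⟩
  · obtain ⟨c, hc, hle⟩ := hcount n (s n)
    refine ⟨c, hle.trans (Nat.cast_le.2 (visitCount_le_of_imp fun k hk hkn m => ?_))⟩
    rcases le_total m (n + 1) with hm | hm
    · by_contra hne
      obtain ⟨b, hb⟩ := Option.ne_none_iff_exists'.1 hne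
      have := (hE m (n + 1) hm).1 _ _ hb
      rw [show (s (n + 1)).1.1 (k * c) = none from hkn] at this
      cases this
    · exact ((hE (n + 1) m hm).2 _ (by exact_mod_cast hc k hk)).trans hkn

/-! ### The minimal subshift -/

lemma continuous_shiftAct {P : Type*} [TopologicalSpace P] (c : G) :
    Continuous (shiftAct c : (G → P) → G → P) :=
  continuous_pi fun g => continuous_apply (g * c)

lemma shiftAct_shiftAct {P : Type*} (c c' : G) (x : G → P) :
    shiftAct c (shiftAct c' x) = shiftAct (c * c') x := by
  ext g
  simp [shiftAct, mul_assoc]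

lemma shiftAct_one {P : Type*} (x : G → P) : shiftAct 1 x = x := by
  ext g
  simp [shiftAct]

open Classical in
/-- A minimal subshift together with a set `J` of free coordinates of density `θ`: all the ways of
filling `J` are allowed, whereas the coordinates of the points of the subshift range in a
finite set outside of a set of density arbitrarily close to `θ`. -/
lemma exists_minimal_subshift [Countable G] [Infinite G] (hG : IsAmenable G) {P : Type*}
    [TopologicalSpace P] [T1Space P] [SecondCountableTopology P] [Nonempty P]
    {θ : ℝ} (hθ : 0 ≤ θ) (hθ1 : θ < 1) :
    ∃ (X : Set (G → P)) (J : Set G) (ω : G → P), IsClosed X ∧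
      (∀ c, ∀ x ∈ X, shiftAct c x ∈ X) ∧
      (∀ y ∈ X, X ⊆ closure (Set.range fun c => shiftAct c y)) ∧
      (∀ y : G → P, (fun g => if g ∈ J then y g else ω g) ∈ X) ∧
      (∀ F : Finset G, ∃ c, θ * F.card ≤ visitCount J F c) ∧
      ∀ ε > 0, ∃ (E : Set G) (A : Set P), A.Finite ∧ DensityLE E (θ + ε) ∧
        ∀ (H : Finset G) (m : ℕ), (∀ c, visitCount E H c ≤ m) → ∀ y ∈ X,
          ∃ S ⊆ H, S.card ≤ m ∧ ∀ h ∈ H, h ∉ S → y h ∈ A := by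
  obtain ⟨e, he⟩ := exists_surjective_nat (Finset G × ℕ)
  let d := TopologicalSpace.denseSeq (G → P)
  obtain ⟨u, hfin, hmono, hdens, hpat, hcount⟩ := exists_partial_configurations hG hθ hθ1
    (fun n => (e n).1) fun n => d (e n).2
  let C : Set (G → P) := {x | ∀ n g a, u n g = some a → x g = a}
  let X₀ : Set (G → P) := {y | ∃ c, ∃ x ∈ C, shiftAct c x = y}
  let J : Set G := {g | ∀ n, u n g = none}
  have hω : ∀ g, ∃ a, g ∉ J → ∃ n, u n g = some a := by
    intro g
    by_cases hg : g ∈ J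
    · exact ⟨Classical.arbitrary P, fun h => (h hg).elim⟩
    · simp only [J, Set.mem_ofPred_eq, not_forall] at hg
      obtain ⟨n, hn⟩ := hg
      obtain ⟨a, ha⟩ := Option.ne_none_iff_exists'.1 hn
      exact ⟨a, fun _ => ⟨n, ha⟩⟩
  choose ω hω using hω
  refine ⟨closure X₀, J, ω, isClosed_closure, fun c x hx => ?_, fun y hy => ?_, fun y => ?_,
    fun F => ?_, fun ε hε => ?_⟩
  · refine map_mem_closure (continuous_shiftAct c) hx ?_
    rintro _ ⟨c', x', hx', rfl⟩
    exact ⟨c * c', x', hx', (shiftAct_shiftAct _ _ _).symm⟩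
  · refine closure_minimal ?_ isClosed_closure
    rintro _ ⟨c, x, hx, rfl⟩
    have hxO : x ∈ closure (Set.range fun c => shiftAct c y) := by
      refine mem_closure_iff.2 fun U hU hxU => ?_
      obtain ⟨K, V, hV, hVU⟩ := isOpen_pi_iff.1 hU x hxU
      have hVo : IsOpen ((K : Set G).pi V) := isOpen_set_pi K.finite_toSet fun k hk => (hV k hk).1
      obtain ⟨j, hj⟩ := (TopologicalSpace.denseRange_denseSeq (G → P)).exists_mem_open hVo
        ⟨x, fun k hk => (hV k hk).2⟩
      obtain ⟨n, hn⟩ := he (K, j)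
      obtain ⟨L, hL⟩ := hpat n
      rw [hn] at hL
      have hcl : IsClosed {z : G → P | ∃ l ∈ L, ∀ k ∈ K, z (k * l) = (u n k).getD (d j k)} := by
        have : {z : G → P | ∃ l ∈ L, ∀ k ∈ K, z (k * l) = (u n k).getD (d j k)} =
            ⋃ l ∈ L, ⋂ k ∈ K, (fun z : G → P => z (k * l)) ⁻¹' {(u n k).getD (d j k)} := by
          ext z
          simp
        rw [this]
        exact L.finite_toSet.isClosed_biUnion fun l _ => isClosed_biInter fun k _ =>
          isClosed_singleton.preimage (continuous_apply _)
      obtain ⟨l, hl, hlk⟩ := closure_minimal (s := X₀) (fun z ⟨c, x', hx', hz⟩ => by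
        obtain ⟨l, hl, hlk⟩ := hL c
        refine ⟨l, hl, fun k hk => ?_⟩
        rw [← hz]
        simpa [shiftAct, mul_assoc] using hx' _ _ _ (hlk k hk)) hcl hy
      refine ⟨shiftAct l y, hVU fun k hk => ?_, l, rfl⟩
      rw [shiftAct, hlk k hk]
      rcases hu : u n k with _ | a
      · exact hj k hk
      · rw [Option.getD_some, ← hx n k a hu]
        exact (hV k hk).2
    refine map_mem_closure (continuous_shiftAct c) hxO ?_
    rintro _ ⟨c', rfl⟩
    exact ⟨c * c', (shiftAct_shiftAct _ _ _).symm⟩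
  · refine subset_closure ⟨1, _, fun n g a hg => ?_, shiftAct_one _⟩
    have hgJ : g ∉ J := fun h => by simp [h n] at hg
    obtain ⟨n', hn'⟩ := hω g hgJ
    have h1 := hmono _ _ _ _ (le_max_left n n') hg
    have h2 := hmono _ _ _ _ (le_max_right n n') hn'
    rw [h1] at h2
    simp [hgJ, Option.some_injective _ h2]
  · obtain ⟨n, hn⟩ := he (F, 0)
    have := hcount n
    rwa [hn] at this
  · obtain ⟨n, hn⟩ := hdens ε hε
    refine ⟨_, some ⁻¹' Set.range (u n),
      (hfin n).preimage (Option.some_injective P).injOn, hn, fun H m hm => ?_⟩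
    have hcl : IsClosed {y : G → P | ∃ S ⊆ H, S.card ≤ m ∧
        ∀ h ∈ H, h ∉ S → y h ∈ some ⁻¹' Set.range (u n)} := by
      have : {y : G → P | ∃ S ⊆ H, S.card ≤ m ∧
          ∀ h ∈ H, h ∉ S → y h ∈ some ⁻¹' Set.range (u n)} =
          ⋃ S ∈ H.powerset.filter (·.card ≤ m), ⋂ h ∈ H \ S,
            (fun y : G → P => y h) ⁻¹' (some ⁻¹' Set.range (u n)) := by
        ext y
        simp [and_assoc]
      rw [this]
      exact (Finset.finite_toSet _).isClosed_biUnion fun S _ => isClosed_biInter fun h _ =>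
        ((hfin n).preimage (Option.some_injective P).injOn).isClosed.preimage (continuous_apply h)
    refine fun y hy => closure_minimal ?_ hcl hy
    rintro _ ⟨c, x, hx, rfl⟩
    refine ⟨H.filter fun h => h * c ∈ {g | u n g = none}, Finset.filter_subset _ _,
      le_of_eq_of_le (by unfold visitCount; congr) (hm c),
      fun h hh hS => ?_⟩
    obtain ⟨a, ha⟩ := Option.ne_none_iff_exists'.1 fun h' => hS (Finset.mem_filter.2 ⟨hh, h'⟩)
    exact ⟨h * c, by rw [ha, shiftAct, hx n _ _ ha]⟩

/-! ### Covers of maps into the skeleta of a cube -/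

open Classical in
/-- Thickened skeleta: disjoint cells of small diameter covering the complement of a finite
subset of the interval, and disjoint cells of small diameter covering this finite set. -/
lemma exists_cells {A : Set unitInterval} (hA : A.Finite) {ε : ℝ} (hε : 0 < ε) :
    ∃ (A' : Set unitInterval) (𝒰 𝒱 : Finset (Set unitInterval)), A ⊆ A' ∧ IsClosed A' ∧
      A'.Nonempty ∧ (∀ U ∈ 𝒰 ∪ 𝒱, IsOpen U ∧ ∀ s ∈ U, ∀ t ∈ U, dist s t < ε) ∧
      (∀ U ∈ 𝒰, ∀ V ∈ 𝒰, ∀ t ∈ U, t ∈ V → U = V) ∧ (∀ U ∈ 𝒱, ∀ V ∈ 𝒱, ∀ t ∈ U, t ∈ V → U = V) ∧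
      (∀ t, t ∉ A' ↔ ∃ U ∈ 𝒰, t ∈ U) ∧ ∀ t ∈ A', ∃ U ∈ 𝒱, t ∈ U := by
  obtain ⟨N, hNf, hN⟩ := Metric.totallyBounded_iff.1
    (isCompact_univ (X := unitInterval)).totallyBounded (ε / 2) (by linarith)
  have hN' : ∀ t, ∃ a ∈ N, dist t a < ε / 2 := fun t => by simpa using hN (Set.mem_univ t)
  have hAN : (A ∪ N).Finite := hA.union hNf
  let P (B : Finset unitInterval) : Set unitInterval :=
    ⋂ a ∈ A ∪ N, if a ∈ B then Set.Ioi a else Set.Iio a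
  let Q (a : unitInterval) : Set unitInterval :=
    Metric.ball a (ε / 2) ∩ ⋂ b ∈ (A ∪ N) \ {a}, {t | dist t a < dist t b}
  have hP : ∀ B t, t ∈ P B ↔ ∀ a ∈ A ∪ N, (a ∈ B → a < t) ∧ (a ∉ B → t < a) := by
    intro B t
    simp only [P, Set.mem_iInter]
    refine forall₂_congr fun a _ => ?_
    by_cases h : a ∈ B <;> simp [h]
  have hQ : ∀ a t, t ∈ Q a ↔ dist t a < ε / 2 ∧ ∀ b ∈ A ∪ N, b ≠ a → dist t a < dist t b := by
    intro a t
    simp only [Q, Set.mem_inter_iff, Metric.mem_ball, Set.mem_iInter, Set.mem_sdiff,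
      Set.mem_singleton_iff, Set.mem_ofPred_eq, and_imp]
  have hPlt : ∀ B, ∀ s ∈ P B, ∀ t ∈ P B, s ≤ t → dist s t < ε := by
    intro B s hs t ht hst
    rw [hP] at hs ht
    have hst' : (s : ℝ) ≤ t := hst
    obtain ⟨a, ha, hd⟩ := hN' ⟨((s : ℝ) + t) / 2,
      by constructor <;> linarith [s.2.1, s.2.2, t.2.1, t.2.2]⟩
    rw [Subtype.dist_eq, Real.dist_eq, abs_lt] at hd ⊢
    simp only at hd
    by_cases hB : a ∈ B
    · have h1 : (a : ℝ) < s := (hs a (Or.inr ha)).1 hB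
      constructor <;> linarith
    · have h1 : (t : ℝ) < a := (ht a (Or.inr ha)).2 hB
      constructor <;> linarith
  refine ⟨A ∪ N, (hAN.toFinset.powerset).image P, hAN.toFinset.image Q, Set.subset_union_left,
    hAN.isClosed, ?_, ?_, ?_, ?_, ?_, ?_⟩
  · obtain ⟨a, ha, -⟩ := hN' 0
    exact ⟨a, Or.inr ha⟩
  · intro U hU
    rcases Finset.mem_union.1 hU with hU | hU
    · obtain ⟨B, -, rfl⟩ := Finset.mem_image.1 hU
      refine ⟨hAN.isOpen_biInter fun a _ => ?_, fun s hs t ht => ?_⟩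
      · split_ifs
        exacts [isOpen_Ioi, isOpen_Iio]
      · rcases le_total s t with h | h
        · exact hPlt B s hs t ht h
        · rw [dist_comm]
          exact hPlt B t ht s hs h
    · obtain ⟨a, -, rfl⟩ := Finset.mem_image.1 hU
      refine ⟨Metric.isOpen_ball.inter ((hAN.subset Set.sdiff_subset).isOpen_biInter fun b _ =>
        isOpen_lt (by fun_prop) (by fun_prop)), fun s hs t ht => ?_⟩
      rw [hQ] at hs ht
      linarith [dist_triangle_right s t a]
  · simp only [Finset.mem_image, forall_exists_index, and_imp, forall_apply_eq_imp_iff₂]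
    intro B hB B' hB' t ht ht'
    rw [hP] at ht ht'
    congr 1
    rw [Finset.mem_powerset] at hB hB'
    ext a
    constructor
    · intro ha
      by_contra h
      have hm := hAN.mem_toFinset.1 (hB ha)
      exact lt_asymm ((ht a hm).1 ha) ((ht' a hm).2 h)
    · intro ha
      by_contra h
      have hm := hAN.mem_toFinset.1 (hB' ha)
      exact lt_asymm ((ht' a hm).1 ha) ((ht a hm).2 h)
  · simp only [Finset.mem_image, forall_exists_index, and_imp, forall_apply_eq_imp_iff₂,
      hAN.mem_toFinset]
    intro a ha b hb t ht ht'
    rw [hQ] at ht ht'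
    by_contra hab
    have hne : a ≠ b := fun h => hab (by rw [h])
    exact lt_asymm (ht.2 b hb hne.symm) (ht'.2 a ha hne)
  · intro t
    simp only [Finset.exists_mem_image, hP]
    constructor
    · intro ht
      refine ⟨hAN.toFinset.filter (· < t), Finset.mem_powerset.2 (Finset.filter_subset _ _),
        fun a ha => ?_⟩
      simp only [Finset.mem_filter, hAN.mem_toFinset, ha, true_and, imp_self, not_lt]
      exact fun h => lt_of_le_of_ne h fun h' => ht (h' ▸ ha)
    · rintro ⟨B, -, h⟩ ht
      by_cases hB : t ∈ B
      · exact lt_irrefl _ ((h t ht).1 hB)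
      · exact lt_irrefl _ ((h t ht).2 hB)
  · intro t ht
    refine ⟨Q t, Finset.mem_image_of_mem _ (hAN.mem_toFinset.2 ht), ?_⟩
    rw [hQ]
    simp only [dist_self, dist_pos]
    exact ⟨by linarith, fun b _ h => h.symm⟩

open Classical in
/-- If at most `m` of the coordinates `φ k x` are outside of a finite set, for all `x`, then there
are open covers of order at most `m` on which all the coordinates oscillate by less than `ε`. -/
lemma exists_cover_ordOn_le {X κ : Type*} [TopologicalSpace X] [Fintype κ]
    {φ : κ → X → unitInterval} (hφ : ∀ k, Continuous (φ k)) {A : Set unitInterval} (hA : A.Finite)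
    {m : ℕ} (hm : ∀ x, ∃ S : Finset κ, S.card ≤ m ∧ ∀ k ∉ S, φ k x ∈ A) {ε : ℝ} (hε : 0 < ε) :
    ∃ β : Finset (Set X), IsOpenCoverOf Set.univ β ∧ ordOn Set.univ β ≤ m ∧
      ∀ U ∈ β, ∀ x ∈ U, ∀ y ∈ U, ∀ k, dist (φ k x) (φ k y) < ε := by
  obtain ⟨A', 𝒰, 𝒱, hAA', hA', hne, hcell, h𝒰, h𝒱, hcov𝒰, hcov𝒱⟩ := exists_cells hA hε
  let D (k : κ) (x : X) : ℝ := Metric.infDist (φ k x) A'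
  have hD : ∀ k, Continuous (D k) := fun k => (Metric.continuous_infDist_pt A').comp (hφ k)
  let I : Finset (Finset κ × (κ → Set unitInterval)) :=
    (Finset.univ ×ˢ Fintype.piFinset fun _ => 𝒰 ∪ 𝒱).filter fun q =>
      ∀ k, (k ∈ q.1 → q.2 k ∈ 𝒰) ∧ (k ∉ q.1 → q.2 k ∈ 𝒱)
  have hI : ∀ S l, (S, l) ∈ I ↔ ∀ k, (k ∈ S → l k ∈ 𝒰) ∧ (k ∉ S → l k ∈ 𝒱) := by
    intro S l
    simp only [I, Finset.mem_filter, Finset.mem_product, Finset.mem_univ, true_and,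
      Fintype.mem_piFinset, and_iff_right_iff_imp]
    intro h k
    by_cases hk : k ∈ S
    · exact Finset.mem_union_left _ ((h k).1 hk)
    · exact Finset.mem_union_right _ ((h k).2 hk)
  have hIcell : ∀ {S l}, (S, l) ∈ I → ∀ k, l k ∈ 𝒰 ∪ 𝒱 := fun h k => by
    simp only [I, Finset.mem_filter, Finset.mem_product, Fintype.mem_piFinset] at h
    exact h.1.2 k
  let U (q : Finset κ × (κ → Set unitInterval)) : Set X :=
    (⋂ k, φ k ⁻¹' q.2 k) ∩ ⋂ i, ⋂ j, ⋂ (_ : i ∈ q.1 ∧ j ∉ q.1), {x | D j x < D i x}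
  have hU : ∀ S l x, x ∈ U (S, l) ↔
      (∀ k, φ k x ∈ l k) ∧ ∀ i j, i ∈ S → j ∉ S → D j x < D i x := by
    intro S l x
    simp only [U, Set.mem_inter_iff, Set.mem_iInter, Set.mem_preimage, Set.mem_ofPred_eq, and_imp]
  refine ⟨I.image U, ⟨?_, ?_⟩, ciSup_le' ?_, ?_⟩
  · intro V hV
    obtain ⟨⟨S, l⟩, hq, rfl⟩ := Finset.mem_image.1 hV
    exact (isOpen_iInter_of_finite fun k => (hcell _ (hIcell hq k)).1.preimage (hφ k)).inter
      (isOpen_iInter_of_finite fun i => isOpen_iInter_of_finite fun j =>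
        isOpen_iInter_of_finite fun _ => isOpen_lt (hD j) (hD i))
  · intro x _
    have hex : ∀ k, ∃ C : Set unitInterval, φ k x ∈ C ∧ (φ k x ∉ A' → C ∈ 𝒰) ∧
        (φ k x ∈ A' → C ∈ 𝒱) := by
      intro k
      by_cases h : φ k x ∈ A'
      · obtain ⟨C, hC, hx⟩ := hcov𝒱 _ h
        exact ⟨C, hx, fun h' => (h' h).elim, fun _ => hC⟩
      · obtain ⟨C, hC, hx⟩ := (hcov𝒰 _).1 h
        exact ⟨C, hx, fun _ => hC, fun h' => (h h').elim⟩
    choose l hl hl𝒰 hl𝒱 using hex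
    refine Set.mem_iUnion₂.2 ⟨U (Finset.univ.filter fun k => φ k x ∉ A', l),
      Finset.mem_image_of_mem _ ((hI _ _).2 fun k => ?_), (hU _ _ _).2 ⟨hl, fun i j hi hj => ?_⟩⟩
    · simp only [Finset.mem_filter, Finset.mem_univ, true_and, not_not]
      exact ⟨hl𝒰 k, hl𝒱 k⟩
    · simp only [Finset.mem_filter, Finset.mem_univ, true_and, not_not] at hi hj
      have h1 : D j x = 0 := Metric.infDist_zero_of_mem hj
      rw [h1]
      exact (hA'.notMem_iff_infDist_pos hne).1 hi
  · rintro ⟨x, -⟩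
    have hex : ∀ V, V ∈ I.image U ∧ x ∈ V → ∃ S l, (S, l) ∈ I ∧ x ∈ U (S, l) ∧ U (S, l) = V := by
      rintro V ⟨hV, hx⟩
      obtain ⟨⟨S, l⟩, hq, rfl⟩ := Finset.mem_image.1 hV
      exact ⟨S, l, hq, hx, rfl⟩
    choose! S l hSI hSx hSV using hex
    have hcard : {V | V ∈ I.image U ∧ x ∈ V}.ncard ≤
        ((Finset.range (m + 1) : Finset ℕ) : Set ℕ).ncard := by
      refine Set.ncard_le_ncard_of_injOn (fun V => (S V).card) (fun V hV => ?_) ?_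
        (Finset.finite_toSet _)
      · obtain ⟨T, hT, hTA⟩ := hm x
        have hsub : S V ⊆ T := fun k hk => by
          by_contra hkT
          have h1 := ((hI _ _).1 (hSI V hV) k).1 hk
          exact (hcov𝒰 _).2 ⟨_, h1, ((hU _ _ _).1 (hSx V hV)).1 k⟩ (hAA' (hTA k hkT))
        simpa [Nat.lt_succ_iff] using (Finset.card_le_card hsub).trans hT
      · intro V hV W hW hVW
        have hx1 := (hU _ _ _).1 (hSx V hV)
        have hx2 := (hU _ _ _).1 (hSx W hW)
        have hS : S V = S W := by
          by_cases h : S V ⊆ S W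
          · exact Finset.eq_of_subset_of_card_le h hVW.ge
          by_cases h' : S W ⊆ S V
          · exact (Finset.eq_of_subset_of_card_le h' hVW.le).symm
          obtain ⟨i, hi, hi'⟩ := Finset.not_subset.1 h
          obtain ⟨j, hj, hj'⟩ := Finset.not_subset.1 h'
          exact (lt_asymm (hx1.2 i j hi hj') (hx2.2 j i hj hi')).elim
        have hl : l V = l W := by
          ext1 k
          have hV' := (hI _ _).1 (hSI V hV) k
          have hW' := (hI _ _).1 (hSI W hW) k
          by_cases hk : k ∈ S V
          · exact h𝒰 _ (hV'.1 hk) _ (hW'.1 (hS ▸ hk)) _ (hx1.1 k) (hx2.1 k)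
          · exact h𝒱 _ (hV'.2 hk) _ (hW'.2 (hS ▸ hk)) _ (hx1.1 k) (hx2.1 k)
        rw [← hSV V hV, ← hSV W hW, hS, hl]
    rw [Set.ncard_coe_finset, Finset.card_range] at hcard
    simpa using hcard
  · intro V hV x hx y hy k
    obtain ⟨⟨S, l⟩, hq, rfl⟩ := Finset.mem_image.1 hV
    exact (hcell _ (hIcell hq k)).2 _ (((hU _ _ _).1 hx).1 k) _ (((hU _ _ _).1 hy).1 k)

/-! ### Widths of covers -/

lemma le_ordOn {Y : Type*} {X : Set Y} {β : Finset (Set Y)} {x : Y} (hx : x ∈ X) {n : ℕ}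
    (h : n + 1 ≤ {U : Set Y | U ∈ β ∧ x ∈ U}.ncard) : n ≤ ordOn X β := by
  refine le_trans (Nat.le_sub_of_add_le h) (le_ciSup (f := fun y : X =>
    {U : Set Y | U ∈ β ∧ (y : Y) ∈ U}.ncard - 1) ⟨β.card, ?_⟩ ⟨x, hx⟩)
  rintro _ ⟨y, rfl⟩
  refine (Nat.sub_le _ _).trans ?_
  rw [← Set.ncard_coe_finset]
  exact Set.ncard_le_ncard (fun U hU => hU.1) β.finite_toSet

lemma mem_FCover {Y H : Type*} {σ : H → Y → Y} {F : Finset H} {α : Finset (Set Y)} {U : Set Y} :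
    U ∈ FCover σ F α ↔ ∃ f : H → Set Y, (∀ g ∈ F, f g ∈ α) ∧ U = ⋂ g ∈ F, σ g ⁻¹' f g := by
  classical
  simp only [FCover, Finset.mem_image, Finset.mem_pi]
  constructor
  · rintro ⟨f, hf, rfl⟩
    refine ⟨fun g => if h : g ∈ F then f g h else ∅, fun g hg => by simpa [hg] using hf g hg, ?_⟩
    refine Set.iInter_congr fun g => Set.iInter_congr fun hg => ?_
    simp only [hg, dif_pos]
  · rintro ⟨f, hf, rfl⟩
    exact ⟨fun g _ => f g, hf, rfl⟩

lemma isOpenCoverOf_FCover {Y H : Type*} [TopologicalSpace Y] {σ : H → Y → Y}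
    (hσ : ∀ g, Continuous (σ g)) (F : Finset H) {α : Finset (Set Y)} (hα : IsOpenCoverOf Set.univ α) :
    IsOpenCoverOf Set.univ (FCover σ F α) := by
  refine ⟨fun U hU => ?_, fun x _ => ?_⟩
  · obtain ⟨f, hf, rfl⟩ := mem_FCover.1 hU
    exact isOpen_biInter_finset fun g hg => (hα.1 _ (hf g hg)).preimage (hσ g)
  · have h : ∀ y, ∃ V ∈ α, y ∈ V := fun y => by simpa using hα.2 (Set.mem_univ y)
    choose V hV hy using h
    exact Set.mem_iUnion₂.2 ⟨_, mem_FCover.2 ⟨fun g => V (σ g x), fun g _ => hV _, rfl⟩,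
      Set.mem_iInter₂.2 fun g _ => hy (σ g x)⟩

lemma Dcov_le {Y : Type*} [TopologicalSpace Y] {X : Set Y} {α β : Finset (Set Y)}
    (hβ : IsOpenCoverOf X β) (h : ∀ U ∈ β, ∃ V ∈ α, U ⊆ V) : Dcov X α ≤ ordOn X β :=
  Nat.sInf_le ⟨β, hβ, h, rfl⟩

lemma le_Dcov {Y : Type*} [TopologicalSpace Y] {X : Set Y} {α : Finset (Set Y)}
    (hα : IsOpenCoverOf X α) {n : ℕ}
    (h : ∀ β, IsOpenCoverOf X β → (∀ U ∈ β, ∃ V ∈ α, U ⊆ V) → n ≤ ordOn X β) : n ≤ Dcov X α := by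
  refine le_csInf ⟨_, α, hα, fun U hU => ⟨U, hU, subset_rfl⟩, rfl⟩ ?_
  rintro _ ⟨β, hβ, hβα, rfl⟩
  exact h β hβ hβα

/-! ### The upper bound -/

lemma exists_window {S ι : Type*} [Fintype ι] {X : Set (S → ι → unitInterval)} (hX : IsClosed X)
    {α : Finset (Set X)} (hα : IsOpenCoverOf Set.univ α) :
    ∃ (W : Finset S) (ε : ℝ), 0 < ε ∧ ∀ x : X, ∃ V ∈ α, ∀ y : X,
      (∀ w ∈ W, dist ((x : S → ι → unitInterval) w) ((y : S → ι → unitInterval) w) < ε) →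
        y ∈ V := by
  have : CompactSpace X := isCompact_iff_compactSpace.1 hX.isCompact
  obtain ⟨n, hn, hn'⟩ := lebesgue_number_lemma (isCompact_univ (X := X)) 
    (U := fun V : α => (V : Set X)) (fun V => hα.1 _ V.2) (by simpa [Set.iUnion_subtype] using hα.2)
  rw [uniformity_subtype, Filter.mem_comap] at hn
  obtain ⟨t, ht, htn⟩ := hn
  rw [Pi.uniformity, Filter.mem_iInf] at ht
  obtain ⟨W, hW, T, hT, rfl⟩ := ht
  have hev : ∀ w ∈ hW.toFinset, ∀ᶠ ε in 𝓝[>] (0 : ℝ), ∀ x y : S → ι → unitInterval,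
      dist (x w) (y w) < ε → ∀ h : w ∈ W, (x, y) ∈ T ⟨w, h⟩ := by
    intro w hw
    have hw' := hW.mem_toFinset.1 hw
    obtain ⟨s, hs, hsT⟩ := Filter.mem_comap.1 (hT ⟨w, hw'⟩)
    obtain ⟨ε, hε, hεs⟩ := Metric.mem_uniformity_dist.1 hs
    filter_upwards [Ioo_mem_nhdsGT hε] with δ hδ x y hxy _
    exact hsT (hεs (hxy.trans hδ.2))
  obtain ⟨ε, hε, hε0⟩ := (((Filter.eventually_all_finset _).2 hev).and self_mem_nhdsWithin).exists
  refine ⟨hW.toFinset, ε, hε0, fun x => ?_⟩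
  obtain ⟨V, hV⟩ := hn' x (Set.mem_univ x)
  refine ⟨V, V.2, fun y hy => hV ?_⟩
  apply htn
  simp only [Set.mem_preimage, Set.mem_iInter]
  rintro ⟨w, hw⟩
  exact hε w (hW.mem_toFinset.2 hw) _ _ (hy w (hW.mem_toFinset.2 hw)) hw

lemma Dcov_FCover_le {ι : Type*} [Fintype ι] {X : Set (G → ι → unitInterval)} (hX : X.Nonempty)
    {σ : G → X → X} (hσ : ∀ g x, (σ g x : G → ι → unitInterval) = shiftAct g x)
    {α : Finset (Set X)} {W : Finset G} {ε : ℝ} (hε : 0 < ε)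
    (hW : ∀ x : X, ∃ V ∈ α, ∀ y : X,
      (∀ w ∈ W, dist ((x : G → ι → unitInterval) w) ((y : G → ι → unitInterval) w) < ε) → y ∈ V)
    [DecidableEq G] {A : Set (ι → unitInterval)} (hA : A.Finite) {F : Finset G} {m : ℕ}
    (hm : ∀ y ∈ X, ∃ S ⊆ W * F, S.card ≤ m ∧ ∀ h ∈ W * F, h ∉ S → y h ∈ A) :
    Dcov Set.univ (FCover σ F α) ≤ m * Fintype.card ι := by
  classical
  obtain ⟨β, hβ, hord, hβε⟩ := exists_cover_ordOn_le (X := X) (κ := ↥(W * F) × ι)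
    (φ := fun k x => (x : G → ι → unitInterval) k.1 k.2) (fun k => (continuous_apply k.2).comp
      ((continuous_apply (k.1 : G)).comp continuous_subtype_val))
    (A := ⋃ i, (fun p => p i) '' A) (Set.finite_iUnion fun i => hA.image _)
    (m := m * Fintype.card ι) (fun x => by
      obtain ⟨S, -, hS, hSA⟩ := hm x x.2
      refine ⟨S.subtype (· ∈ W * F) ×ˢ Finset.univ, ?_, ?_⟩
      · rw [Finset.card_product, Finset.card_univ]
        gcongr
        rw [Finset.card_subtype]
        exact (Finset.card_filter_le _ _).trans hS
      · rintro ⟨⟨h, hh⟩, i⟩ hS'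
        simp only [Finset.mem_product, Finset.mem_subtype, Finset.mem_univ, and_true] at hS'
        exact Set.mem_iUnion.2 ⟨i, _, hSA h hh hS', rfl⟩) hε
  refine (Dcov_le hβ fun U hU => ?_).trans hord
  choose V hVα hV using hW
  have : Nonempty X := hX.to_subtype
  obtain ⟨x, hx⟩ : ∃ x : X, U.Nonempty → x ∈ U := by
    by_cases h : U.Nonempty
    · exact ⟨h.some, fun _ => h.some_mem⟩
    · exact ⟨Classical.arbitrary X, fun h' => (h h').elim⟩
  refine ⟨_, mem_FCover.2 ⟨fun g => V (σ g x), fun g _ => hVα _, rfl⟩, fun y hy =>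
    Set.mem_iInter₂.2 fun g hg => hV _ _ fun w hw => ?_⟩
  rw [hσ, hσ, dist_pi_lt_iff hε]
  exact fun i => hβε U hU x (hx ⟨y, hy⟩) y hy (⟨w * g, Finset.mul_mem_mul hw hg⟩, i)

lemma visitCount_le_add_card_sdiff (E : Set G) (F H : Finset G) (c : G) [DecidableEq G] :
    visitCount E H c ≤ visitCount E F c + (H \ F).card := by
  classical
  refine (Finset.card_le_card fun h hh => ?_).trans (Finset.card_union_le _ _)
  rw [Finset.mem_filter] at hh
  by_cases hF : h ∈ F
  · exact Finset.mem_union_left _ (Finset.mem_filter.2 ⟨hF, hh.2⟩)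
  · exact Finset.mem_union_right _ (Finset.mem_sdiff.2 ⟨hh.1, hF⟩)

lemma mdim_le {ι : Type*} [Fintype ι] {X : Set (G → ι → unitInterval)} (hX : X.Nonempty)
    (hXc : IsClosed X)
    {σ : G → X → X} (hσ : ∀ g x, (σ g x : G → ι → unitInterval) = shiftAct g x) {θ : ℝ}
    (hθ : 0 ≤ θ)
    (h : ∀ ε > 0, ∃ (E : Set G) (A : Set (ι → unitInterval)), A.Finite ∧ DensityLE E (θ + ε) ∧
        ∀ (H : Finset G) (m : ℕ), (∀ c, visitCount E H c ≤ m) → ∀ y ∈ X,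
          ∃ S ⊆ H, S.card ≤ m ∧ ∀ h ∈ H, h ∉ S → y h ∈ A)
    {Fo : ℕ → Finset G} (hFo : IsFolnerSeq G Fo) :
    mdim σ Set.univ Fo ≤ ENNReal.ofReal (Fintype.card ι * θ) := by
  classical
  refine iSup₂_le fun α hα => ENNReal.le_of_forall_pos_le_add fun η hη _ => ?_
  obtain ⟨W, ε, hε, hW⟩ := exists_window hXc hα
  let d : ℝ := Fintype.card ι
  let δ : ℝ := η / (3 * (d + 1))
  have hd : 0 ≤ d := Nat.cast_nonneg _
  have hη' : (0 : ℝ) < η := hη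
  have hδ : 0 < δ := by positivity
  obtain ⟨E, A, hA, hE, hEA⟩ := h δ hδ
  refine Filter.limsup_le_of_le (h := ?_)
  filter_upwards [hE.eventually_visitCount_le (t' := θ + 2 * δ) (by linarith) hFo,
    hFo.eventually_card_mul_sdiff_le W hδ] with n hn hn'
  have hpos : (0 : ℝ) < (Fo n).card := by exact_mod_cast (hFo.1 n).card_pos
  have hD := Dcov_FCover_le hX hσ hε hW hA (F := Fo n) (hEA (W * Fo n)
    ⌊(θ + 3 * δ) * (Fo n).card⌋₊ fun c => Nat.le_floor (by
      calc (visitCount E (W * Fo n) c : ℝ) ≤ visitCount E (Fo n) c + ((W * Fo n) \ Fo n).card := by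
            exact_mod_cast visitCount_le_add_card_sdiff E (Fo n) (W * Fo n) c
        _ ≤ (θ + 2 * δ) * (Fo n).card + δ * (Fo n).card := add_le_add (hn c) hn'
        _ = _ := by ring))
  have hD₁ : (Dcov Set.univ (FCover σ (Fo n) α) : ℝ) ≤
      ⌊(θ + 3 * δ) * (Fo n).card⌋₊ * (Fintype.card ι : ℝ) := by exact_mod_cast hD
  have hD' : (Dcov Set.univ (FCover σ (Fo n) α) : ℝ) ≤ (d * θ + η) * (Fo n).card := by
    calc (Dcov Set.univ (FCover σ (Fo n) α) : ℝ)
        ≤ ⌊(θ + 3 * δ) * (Fo n).card⌋₊ * d := hD₁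
      _ ≤ ((θ + 3 * δ) * (Fo n).card) * d := by
        gcongr
        exact Nat.floor_le (by positivity)
      _ = (d * θ + 3 * δ * d) * (Fo n).card := by ring
      _ ≤ _ := by
        gcongr
        simp only [δ]
        rw [mul_div_assoc', div_mul_eq_mul_div, div_le_iff₀ (by positivity)]
        nlinarith
  refine ENNReal.div_le_of_le_mul ?_
  rw [← ENNReal.ofReal_coe_nnreal, ← ENNReal.ofReal_add (by positivity) hη'.le,
    ← ENNReal.ofReal_natCast, ← ENNReal.ofReal_natCast, ← ENNReal.ofReal_mul (by positivity)]
  exact ENNReal.ofReal_le_ofReal hD'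

/-! ### The lower bound -/

open Classical in
/-- The cover of a subshift separating the opposite faces of the coordinates in `T` at the
identity. -/
noncomputable def faceCover {ι : Type*} (X : Set (G → ι → unitInterval)) (T : Finset ι) :
    Finset (Set X) :=
  Finset.univ.image fun s : T → Bool =>
    {x : X | ∀ i : T, (x : G → ι → unitInterval) 1 i ≠ if s i then 0 else 1}

lemma isOpenCoverOf_faceCover {ι : Type*} (X : Set (G → ι → unitInterval)) (T : Finset ι) :
    IsOpenCoverOf Set.univ (faceCover X T) := by
  classical
  refine ⟨fun U hU => ?_, fun x _ => ?_⟩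
  · obtain ⟨s, -, rfl⟩ := Finset.mem_image.1 hU
    rw [Set.ofPred_forall]
    exact isOpen_iInter_of_finite fun i => isOpen_ne.preimage
      ((continuous_apply (i : ι)).comp ((continuous_apply (1 : G)).comp continuous_subtype_val))
  · refine Set.mem_iUnion₂.2 ⟨_, Finset.mem_image_of_mem _ (Finset.mem_univ fun i : T =>
      decide ((x : G → ι → unitInterval) 1 i ≠ 0)), fun i => ?_⟩
    by_cases h : (x : G → ι → unitInterval) 1 i = 0 <;> simp [h]

open Classical in
lemma visitCount_mul_le_Dcov {ι : Type*} {X : Set (G → ι → unitInterval)} {σ : G → X → X}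
    (hσc : ∀ g, Continuous (σ g))
    (hσ : ∀ g x, (σ g x : G → ι → unitInterval) = shiftAct g x)
    (hXs : ∀ c, ∀ x ∈ X, shiftAct c x ∈ X) {J : Set G} {ω : G → ι → unitInterval}
    (hJ : ∀ y : G → ι → unitInterval, (fun g => if g ∈ J then y g else ω g) ∈ X)
    (T : Finset ι) (F : Finset G) (c : G) :
    visitCount J F c * T.card ≤ Dcov Set.univ (FCover σ F (faceCover X T)) := by
  let S := F.filter fun f => f * c ∈ J
  let fill (z : ↥S × ↥T → unitInterval) (g : G) (i : ι) : unitInterval :=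
    if h : g * c⁻¹ ∈ S ∧ i ∈ T then z (⟨g * c⁻¹, h.1⟩, ⟨i, h.2⟩) else 0
  let Φ (z : ↥S × ↥T → unitInterval) : X := ⟨_, hXs c _ (hJ (fill z))⟩
  have hΦ : ∀ z f i, (Φ z : G → ι → unitInterval) (f : S) (i : T) = z (f, i) := by
    intro z f i
    have hf : (f : G) * c ∈ J := (Finset.mem_filter.1 f.2).2
    simp [Φ, fill, shiftAct, hf]
  have hΦc : Continuous Φ := by
    refine Continuous.subtype_mk (continuous_pi fun g => continuous_pi fun i => ?_) _
    simp only [shiftAct]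
    split_ifs
    · simp only [fill]
      split_ifs
      · exact continuous_apply _
      · exact continuous_const
    · exact continuous_const
  refine le_Dcov (isOpenCoverOf_FCover hσc F (isOpenCoverOf_faceCover X T)) fun β hβ hβα => ?_
  obtain ⟨z, hz⟩ := exists_mem_of_cube_cover (fun b : β => Φ ⁻¹' (b : Set X))
    (fun b => (hβ.1 _ b.2).preimage hΦc) (fun z => by
      obtain ⟨V, hV, hz⟩ := Set.mem_iUnion₂.1 (hβ.2 (Set.mem_univ (Φ z)))
      exact ⟨⟨V, hV⟩, hz⟩) (by
    rintro ⟨b, hb⟩ ⟨f, i⟩ x hx y hy h0 h1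
    obtain ⟨V, hV, hbV⟩ := hβα b hb
    obtain ⟨v, hv, rfl⟩ := mem_FCover.1 hV
    have hfF : (f : G) ∈ F := (Finset.mem_filter.1 f.2).1
    obtain ⟨s, -, hs⟩ := Finset.mem_image.1 (hv f hfF)
    have hx' := Set.mem_iInter₂.1 (hbV hx) f hfF
    have hy' := Set.mem_iInter₂.1 (hbV hy) f hfF
    rw [← hs] at hx' hy'
    have hx'' := hx' i
    have hy'' := hy' i
    rw [hσ, shiftAct, one_mul, hΦ] at hx'' hy''
    rcases hsi : s i <;> simp_all)
  refine le_ordOn (Set.mem_univ (Φ z)) ?_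
  have hcard : Fintype.card (↥S × ↥T) = visitCount J F c * T.card := by
    rw [Fintype.card_prod, Fintype.card_coe, Fintype.card_coe]
    rfl
  rw [hcard] at hz
  refine hz.trans ?_
  rw [← Set.ncard_image_of_injective _ Subtype.val_injective]
  refine Set.ncard_le_ncard ?_ (β.finite_toSet.subset fun U hU => hU.1)
  rintro _ ⟨b, hb, rfl⟩
  exact ⟨b.2, hb⟩

open Classical in
lemma le_mdim {ι : Type*} {X : Set (G → ι → unitInterval)} {σ : G → X → X}
    (hσc : ∀ g, Continuous (σ g))
    (hσ : ∀ g x, (σ g x : G → ι → unitInterval) = shiftAct g x)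
    (hXs : ∀ c, ∀ x ∈ X, shiftAct c x ∈ X) {J : Set G} {ω : G → ι → unitInterval}
    (hJ : ∀ y : G → ι → unitInterval, (fun g => if g ∈ J then y g else ω g) ∈ X)
    {θ : ℝ} (hθ : 0 ≤ θ) (hJθ : ∀ F : Finset G, ∃ c, θ * F.card ≤ visitCount J F c)
    {Fo : ℕ → Finset G} (hFo : IsFolnerSeq G Fo) (T : Finset ι) :
    ENNReal.ofReal (T.card * θ) ≤ mdim σ Set.univ Fo := by
  refine le_trans ?_ (le_iSup₂ (f := fun α (_ : α ∈ {α | IsOpenCoverOf Set.univ α}) =>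
    Filter.limsup (fun n => (Dcov Set.univ (FCover σ (Fo n) α) : ℝ≥0∞) / ((Fo n).card : ℝ≥0∞))
      Filter.atTop) (faceCover X T) (isOpenCoverOf_faceCover X T))
  refine Filter.le_limsup_of_le (h := fun b hb => ?_)
  obtain ⟨n, hn⟩ := hb.exists
  refine le_trans ?_ hn
  obtain ⟨c, hc⟩ := hJθ (Fo n)
  have hD := visitCount_mul_le_Dcov hσc hσ hXs hJ T (Fo n) c
  rw [ENNReal.le_div_iff_mul_le (Or.inl (by simpa using (hFo.1 n).ne_empty))
    (Or.inl (ENNReal.natCast_ne_top _)), ← ENNReal.ofReal_natCast, ← ENNReal.ofReal_natCast,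
    ← ENNReal.ofReal_mul (by positivity)]
  refine ENNReal.ofReal_le_ofReal ?_
  calc (T.card : ℝ) * θ * (Fo n).card = T.card * (θ * (Fo n).card) := by ring
    _ ≤ T.card * visitCount J (Fo n) c := by gcongr
    _ ≤ _ := by
      rw [mul_comm]
      exact_mod_cast hD

/-! ### Minimal systems of given mean dimension -/

lemma exists_minimal_system {G : Type} [Group G] [Countable G] [Infinite G] (hG : IsAmenable G)
    (ι : Type) [Countable ι] {θ : ℝ} (hθ : 0 ≤ θ) (hθ1 : θ < 1) :
    ∃ S : GSystem G,
      (∀ y : S.X, (Set.univ : Set S.X) ⊆ closure (Set.range fun g : G => S.act g y)) ∧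
      ∀ Fo : ℕ → Finset G, IsFolnerSeq G Fo →
        (∀ T : Finset ι, ENNReal.ofReal (T.card * θ) ≤ mdim S.act (Set.univ : Set S.X) Fo) ∧
        ∀ [Fintype ι], mdim S.act (Set.univ : Set S.X) Fo ≤
          ENNReal.ofReal (Fintype.card ι * θ) := by
  obtain ⟨X, J, ω, hXc, hXs, hmin, hJ, hJθ, hA⟩ :=
    exists_minimal_subshift hG (P := ι → unitInterval) hθ hθ1
  let σ : G → X → X := fun g x => ⟨shiftAct g x, hXs g x x.2⟩
  have hσc : ∀ g, Continuous (σ g) := fun g =>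
    ((continuous_shiftAct g).comp continuous_subtype_val).subtype_mk _
  have hσ : ∀ g x, (σ g x : G → ι → unitInterval) = shiftAct g x := fun _ _ => rfl
  refine ⟨{ X := X
            ms := TopologicalSpace.metrizableSpaceMetric X
            compact := isCompact_iff_compactSpace.1 hXc.isCompact
            act := σ
            cont := hσc
            act_one := ?_
            act_mul := fun g h => ?_ }, fun y x _ => ?_, fun Fo hFo => ⟨fun T => ?_, ?_⟩⟩
  · ext1 x
    exact Subtype.ext (shiftAct_one _)
  · ext1 x
    exact Subtype.ext (shiftAct_shiftAct _ _ _).symm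
  · have h := hmin y y.2 x.2
    refine closure_subtype.2 ?_
    convert h using 2
    ext z
    simp [σ]
  · exact le_mdim hσc hσ hXs hJ hθ hJθ hFo T
  · intro _
    exact mdim_le ⟨_, hJ ω⟩ hXc hσ hθ hA hFo

section Transport

variable {G' : Type*} [Group G']

lemma IsFolnerSeq.map (e : G ≃* G') {F : ℕ → Finset G} (hF : IsFolnerSeq G F) :
    IsFolnerSeq G' fun n => (F n).map e.toEquiv.toEmbedding := by
  refine ⟨fun n => (hF.1 n).map, fun g => ?_⟩
  convert hF.2 (e.symm g) using 4 with n
  · have : symmDiff (g • (((F n).map e.toEquiv.toEmbedding : Finset G') : Set G'))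
        ((F n).map e.toEquiv.toEmbedding : Finset G') =
        e '' symmDiff (e.symm g • (F n : Set G)) (F n : Set G) := by
      rw [Set.image_symmDiff e.injective]
      congr 1
      · ext x
        simp [Set.mem_smul_set, Finset.coe_map]
      · simp
    rw [this, Set.ncard_image_of_injective _ e.injective]
  · simp

lemma mdim_comp {Y : Type*} [TopologicalSpace Y] (e : G ≃* G') (σ : G' → Y → Y) (X : Set Y)
    (F : ℕ → Finset G) : mdim (fun g => σ (e g)) X F =
      mdim σ X fun n => (F n).map e.toEquiv.toEmbedding := by
  have h : ∀ (A : Finset G) (α : Finset (Set Y)), FCover (fun g => σ (e g)) A α =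
      FCover σ (A.map e.toEquiv.toEmbedding) α := by
    intro A α
    ext U
    rw [mem_FCover, mem_FCover]
    have hA : ∀ p : G' → Prop,
        (∀ g ∈ A.map e.toEquiv.toEmbedding, p g) ↔ ∀ g ∈ A, p (e g) :=
      fun p => ⟨fun h g hg => h _ (Finset.mem_map_of_mem _ hg), fun h g hg => by
        obtain ⟨a, ha, rfl⟩ := Finset.mem_map.1 hg
        exact h a ha⟩
    constructor
    · rintro ⟨f, hf, rfl⟩
      refine ⟨fun g => f (e.symm g), (hA _).2 (by simpa using hf), Set.ext fun x => ?_⟩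
      rw [Set.mem_iInter₂, Set.mem_iInter₂, hA]
      simp
    · rintro ⟨f, hf, rfl⟩
      refine ⟨fun g => f (e g), (hA _).1 hf, Set.ext fun x => ?_⟩
      rw [Set.mem_iInter₂, Set.mem_iInter₂, hA]
  simp only [mdim, h, Finset.card_map]

end Transport

/-- For a countable infinite amenable group, the mean topological
dimensions of minimal `G`-systems take all values in `[0, +∞]`. -/
theorem minimal_systems_all_mdim_values
    {G : Type*} [Group G] [Countable G] [Infinite G] (hG : IsAmenable G) (ρ : ℝ≥0∞) :
    ∃ S : GSystem G,
      (∀ y : S.X, (Set.univ : Set S.X) ⊆ closure (Set.range fun g : G => S.act g y)) ∧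
      ∀ Fo : ℕ → Finset G, IsFolnerSeq G Fo → mdim S.act (Set.univ : Set S.X) Fo = ρ := by
  let e : G ≃* Shrink.{0} G := (Shrink.mulEquiv).symm
  have : Countable (Shrink.{0} G) := e.symm.injective.countable
  have : Infinite (Shrink.{0} G) := e.toEquiv.infinite_iff.1 inferInstance
  have hG' : IsAmenable (Shrink.{0} G) := hG.imp' _ fun F hF => hF.map e
  suffices h : ∃ S : GSystem (Shrink.{0} G),
      (∀ y : S.X, (Set.univ : Set S.X) ⊆ closure (Set.range fun g => S.act g y)) ∧
      ∀ Fo, IsFolnerSeq (Shrink.{0} G) Fo → mdim S.act (Set.univ : Set S.X) Fo = ρ by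
    obtain ⟨S, hS, hρ⟩ := h
    refine ⟨{ X := S.X
              compact := S.compact
              act := fun g => S.act (e g)
              cont := fun g => S.cont _
              act_one := by rw [map_one, S.act_one]
              act_mul := fun g h => by rw [map_mul, S.act_mul] }, fun y => ?_, fun Fo hFo => ?_⟩
    · exact (hS y).trans (closure_mono (by
        rintro _ ⟨g, rfl⟩
        exact ⟨e.symm g, by simp⟩))
    · exact (mdim_comp e S.act _ Fo).trans (hρ _ (hFo.map e))
  rcases eq_or_ne ρ ⊤ with rfl | hρ
  · obtain ⟨S, hS, hS'⟩ := exists_minimal_system hG' ℕ (θ := 1 / 2) (by norm_num) (by norm_num)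
    refine ⟨S, hS, fun Fo hFo => ENNReal.eq_top_of_forall_nnreal_le fun r => ?_⟩
    obtain ⟨n, hn⟩ := exists_nat_ge (2 * (r : ℝ))
    refine le_trans ?_ ((hS' Fo hFo).1 (Finset.range n))
    rw [← ENNReal.ofReal_coe_nnreal]
    refine ENNReal.ofReal_le_ofReal ?_
    rw [Finset.card_range]
    linarith
  · let d := ⌊ρ.toReal⌋₊ + 1
    have hd : (0 : ℝ) < d := by positivity
    obtain ⟨S, hS, hS'⟩ := exists_minimal_system hG' (Fin d) (θ := ρ.toReal / d) (by positivity)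
      ((div_lt_one hd).2 (by exact_mod_cast Nat.lt_floor_add_one ρ.toReal))
    have hval : ENNReal.ofReal (d * (ρ.toReal / d)) = ρ := by
      rw [mul_div_cancel₀ _ hd.ne', ENNReal.ofReal_toReal hρ]
    refine ⟨S, hS, fun Fo hFo => le_antisymm ?_ ?_⟩
    · have := (hS' Fo hFo).2
      rwa [Fintype.card_fin, hval] at this
    · have := (hS' Fo hFo).1 Finset.univ
      rwa [Finset.card_univ, Fintype.card_fin, hval] at this
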